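/- Let (G, o) be a sourced Eulerian digraph. Then there is at most one proper Gibbs measure on Eulerian paths from o to ∞ in G. -/

import Mathlib

open MeasureTheory Filter Set
open scoped ENNReal

namespace DF

/-! ### Sequences over a countable state space -/

variable {S : Type}

/-- The number of transitions from `u` to `v` among the first `n` steps of the sequence `x`. -/
noncomputable def transCount (x : ℕ → S) (n : ℕ) (u v : S) : ℕ :=
  Set.ncard {i : ℕ | i < n ∧ x i = u ∧ x (i + 1) = v}

/-- The equivalence `(x₀,…,xₙ) ≃ (y₀,…,yₙ)` of finite sequences: same initial state and the same
transition counts between every ordered pair of states. -/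
def FinEquiv (x y : ℕ → S) (n : ℕ) : Prop :=
  x 0 = y 0 ∧ ∀ u v : S, transCount x n u v = transCount y n u v

/-- The equivalence `x ≃ y` of infinite sequences: they eventually agree and their initial
segments up to that point are `≃`-equivalent. -/
def InfEquiv (x y : ℕ → S) : Prop :=
  ∃ N : ℕ, (∀ n : ℕ, N ≤ n → x n = y n) ∧ FinEquiv x y N

/-- The transition numbers `M(u,v) = #{i ≥ 0 : (xᵢ, xᵢ₊₁) = (u,v)}` of an infinite sequence. -/
noncomputable def transNum (x : ℕ → S) (u v : S) : ℕ∞ :=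
  Set.encard {i : ℕ | x i = u ∧ x (i + 1) = v}

/-- The sigma-algebra on `S^ℕ` generated by the transition numbers. -/
noncomputable def transSigma (S : Type) : MeasurableSpace (ℕ → S) :=
  ⨆ u : S, ⨆ v : S, MeasurableSpace.comap (fun x => transNum x u v) (⊤ : MeasurableSpace ℕ∞)

/-- The tail sigma-algebra `⋂ₙ σ(Xₙ, Xₙ₊₁, …)` on `S^ℕ`. -/
def tailSigma (S : Type) [MeasurableSpace S] : MeasurableSpace (ℕ → S) :=
  ⨅ n : ℕ, MeasurableSpace.comap (fun (x : ℕ → S) (i : ℕ) => x (i + n))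
    (inferInstance : MeasurableSpace (ℕ → S))

/-- A measure on `S^ℕ` is partially exchangeable if any two `≃`-equivalent finite initial
segments have the same probability. -/
def PartiallyExchangeable [MeasurableSpace S] (μ : Measure (ℕ → S)) : Prop :=
  ∀ (n : ℕ) (x y : ℕ → S), FinEquiv x y n →
    μ {ω | ∀ i ≤ n, ω i = x i} = μ {ω | ∀ i ≤ n, ω i = y i}

/-- The set of partially exchangeable probability measures on `S^ℕ`. -/
def PEProb (S : Type) [MeasurableSpace S] : Set (Measure (ℕ → S)) :=
  {μ | μ Set.univ = 1 ∧ PartiallyExchangeable μ}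

/-- `μ` is an extreme point of the convex set of partially exchangeable probability measures. -/
def IsExtremePE [MeasurableSpace S] (μ : Measure (ℕ → S)) : Prop :=
  μ ∈ PEProb S ∧
    ∀ μ₁ ∈ PEProb S, ∀ μ₂ ∈ PEProb S, ∀ t : ℝ≥0∞, 0 < t → t < 1 →
      μ = t • μ₁ + (1 - t) • μ₂ → μ₁ = μ₂

/-! ### Digraphs -/

/-- A digraph on vertex set `V` with edge set `E`: each edge has a tail (`src`) and head (`dst`).
Multiple edges and loops are allowed. -/
structure DigraphStruct (V E : Type) where
  src : E → V
  dst : E → V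

namespace DigraphStruct

variable {V E : Type} (G : DigraphStruct V E)

def outEdges (v : V) : Set E := {e | G.src e = v}

def inEdges (v : V) : Set E := {e | G.dst e = v}

noncomputable def outDeg (v : V) : ℕ := (G.outEdges v).ncard

noncomputable def inDeg (v : V) : ℕ := (G.inEdges v).ncard

def LocallyFinite : Prop := ∀ v : V, (G.outEdges v).Finite ∧ (G.inEdges v).Finite

/-- Adjacency in the underlying undirected graph. -/
def undirAdj (u v : V) : Prop :=
  ∃ e : E, (G.src e = u ∧ G.dst e = v) ∨ (G.src e = v ∧ G.dst e = u)

/-- `G` is connected as an undirected graph. -/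
def Connected : Prop := ∀ u v : V, Relation.ReflTransGen G.undirAdj u v

def dirAdj (u v : V) : Prop := ∃ e : E, G.src e = u ∧ G.dst e = v

/-- One step along an edge of the edge set `B`. -/
def step (B : Set E) (u v : V) : Prop := ∃ e ∈ B, G.src e = u ∧ G.dst e = v

/-- `(G,o)` is an infinite sourced Eulerian digraph (with sink at infinity). -/
structure IsSourcedEulerian (o : V) : Prop where
  infinite : Infinite V
  locFin : G.LocallyFinite
  conn : G.Connected
  balanced : ∀ v : V, v ≠ o → G.inDeg v = G.outDeg v
  source : G.outDeg o = G.inDeg o + 1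

/-- The reversal of `G`: head and tail of every edge are exchanged. -/
def rev : DigraphStruct V E := ⟨G.dst, G.src⟩

/-- One-step transition probability of the random walk on `G`. -/
noncomputable def stepProb (u v : V) : ℝ≥0∞ :=
  ({e : E | G.src e = u ∧ G.dst e = v}.ncard : ℝ≥0∞) / (G.outDeg u : ℝ≥0∞)

open Classical in
/-- `μ` is the law of the random walk on `G` started at `o`, characterised through its cylinder
probabilities. -/
def IsWalkLaw [MeasurableSpace V] (o : V) (μ : Measure (ℕ → V)) : Prop :=
  μ Set.univ = 1 ∧
    ∀ (n : ℕ) (x : ℕ → V),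
      μ {ω | ∀ i ≤ n, ω i = x i} =
        if x 0 = o then ∏ i ∈ Finset.range n, G.stepProb (x i) (x (i + 1)) else 0

/-- `G` is transient: from every starting point, the random walk on `G` visits every vertex at
most finitely often almost surely. -/
def TransientDigraph [MeasurableSpace V] : Prop :=
  ∀ (o : V) (μ : Measure (ℕ → V)),
    G.IsWalkLaw o μ → μ {ω | ∀ v : V, {i : ℕ | ω i = v}.Finite} = 1

/-- An infinite path in `G` indexed by `ℕ`, encoded by its sequence of edges. -/
def IsInfPath (γ : ℕ → E) : Prop := ∀ i : ℕ, G.dst (γ i) = G.src (γ (i + 1))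

/-- A transient path: it visits every vertex at most finitely often. -/
def IsTransientPath (γ : ℕ → E) : Prop := ∀ v : V, {i : ℕ | G.src (γ i) = v}.Finite

/-- The edge set of the last-exit arboretum `𝓛(γ)`: the edges crossed by `γ` as it exits their
tail for the last time. -/
def lastExitSet (γ : ℕ → E) : Set E :=
  {e | ∃ i : ℕ, γ i = e ∧ ∀ j : ℕ, i < j → G.src (γ j) ≠ G.src (γ i)}

end DigraphStruct

/-! ### Finite paths, Eulerian paths, arborescences -/

/-- `IsPathList G o z P` means that the list of edges `P` forms a directed path from `o`
to `z` in `G`. -/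
def IsPathList {V E : Type} (G : DigraphStruct V E) : V → V → List E → Prop
  | o, z, [] => o = z
  | o, z, e :: es => G.src e = o ∧ IsPathList G (G.dst e) z es

/-- `P` is an Eulerian path from `o` to `z`: a path crossing every edge exactly once. -/
def IsEulerList {V E : Type} (G : DigraphStruct V E) (o z : V) (P : List E) : Prop :=
  IsPathList G o z P ∧ P.Nodup ∧ ∀ e : E, e ∈ P

/-- `B` is (the edge set of) a spanning in-arborescence of `G` rooted at `z`. -/
def IsFinArb {V E : Type} (G : DigraphStruct V E) (z : V) (B : Set E) : Prop :=
  (∀ e ∈ B, G.src e ≠ z) ∧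
  (∀ v : V, v ≠ z → ∃! e : E, e ∈ B ∧ G.src e = v) ∧
  (∀ v : V, Relation.ReflTransGen (G.step B) v z)

/-- `(G,o,z)` is a finite Eulerian digraph with source `o` and sink `z`. -/
structure IsFinEulerian {V E : Type} (G : DigraphStruct V E) (o z : V) : Prop where
  finV : Finite V
  finE : Finite E
  reach_from : ∀ v : V, Relation.ReflTransGen G.dirAdj o v
  reach_to : ∀ v : V, Relation.ReflTransGen G.dirAdj v z
  bal_ne : o ≠ z → (∀ v : V, v ≠ o → v ≠ z → G.inDeg v = G.outDeg v) ∧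
      G.outDeg o = G.inDeg o + 1 ∧ G.inDeg z = G.outDeg z + 1
  bal_eq : o = z → ∀ v : V, G.inDeg v = G.outDeg v

/-! ### Wired uniform spanning in-arborescences -/

/-- An exhaustion of the vertex set by finite subsets. -/
def IsExhaustion {V : Type} (Vn : ℕ → Set V) : Prop :=
  (∀ n, (Vn n).Finite) ∧ (∀ n, Vn n ⊆ Vn (n + 1)) ∧ (⋃ n, Vn n) = Set.univ

/-- `B` is (the edge set of) a spanning in-arborescence of the wired graph `G_U^*`
(all vertices outside `U` identified to a single boundary vertex) rooted at the boundary. -/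
def IsWiredArb {V E : Type} (G : DigraphStruct V E) (U : Set V) (B : Set E) : Prop :=
  (∀ e ∈ B, G.src e ∈ U) ∧ (∀ v ∈ U, ∃! e : E, e ∈ B ∧ G.src e = v) ∧
  (∀ v ∈ U, ∃ v' : V, v' ∉ U ∧ Relation.ReflTransGen (G.step B) v v')

/-- The probability, under the uniform spanning in-arborescence of the wired graph `G_U^*`
rooted at the boundary, that all edges of `F` are present. -/
noncomputable def wiredUACyl {V E : Type} (G : DigraphStruct V E) (U : Set V) (F : Finset E) :
    ℝ≥0∞ :=
  (Nat.card {B : Set E // IsWiredArb G U B ∧ (F : Set E) ⊆ B} : ℝ≥0∞) /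
    (Nat.card {B : Set E // IsWiredArb G U B} : ℝ≥0∞)

/-- `κ` is the law of the wired uniform spanning in-arboretum of `G` (as a random edge set,
encoded as an element of `E → Bool`): its cylinder probabilities are the limits along any
exhaustion of the uniform spanning in-arborescence measures of the wired graphs. -/
def IsWUALaw {V E : Type} (G : DigraphStruct V E) (κ : Measure (E → Bool)) : Prop :=
  κ Set.univ = 1 ∧
    ∀ Vn : ℕ → Set V, IsExhaustion Vn → ∀ F : Finset E,
      Filter.Tendsto (fun n => wiredUACyl G (Vn n) F) Filter.atTop
        (nhds (κ {A | ∀ e ∈ F, A e = true}))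

/-- A spanning in-arboretum rooted at infinity all of whose components are one-ended:
every vertex has out-degree exactly one, and the past of every vertex is finite. -/
def IsOneEndedSpanningArb {V E : Type} (G : DigraphStruct V E) (A : Set E) : Prop :=
  (∀ v : V, ∃! e : E, e ∈ A ∧ G.src e = v) ∧
    ∀ v : V, {u : V | Relation.ReflTransGen (G.step A) u v}.Finite

/-! ### Proper Gibbs measures on Eulerian paths -/

/-- `w` is a finite path in `G` starting at `o` (encoded by its edges). -/
def PrefixPath {V E : Type} (G : DigraphStruct V E) (o : V) {n : ℕ} (w : Fin n → E) : Prop :=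
  (∀ h : 0 < n, G.src (w ⟨0, h⟩) = o) ∧
    ∀ (i : ℕ) (h : i + 1 < n), G.dst (w ⟨i, Nat.lt_of_succ_lt h⟩) = G.src (w ⟨i + 1, h⟩)

/-- A proper Gibbs measure on Eulerian paths from `o` to `∞` in `G`: a probability measure on
edge sequences, supported on half-infinite paths started at `o` crossing every edge exactly once,
such that conditionally on the steps after time `n` the first `n` steps are a uniform Eulerian
path (from `o`, in the digraph spanned by the edges not crossed after time `n`, to the position
at time `n`). Uniformity is expressed by invariance under replacing the first `n` steps by any
other path from `o` crossing the same set of edges. -/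
def ProperGibbs {V E : Type} [MeasurableSpace E] (G : DigraphStruct V E) (o : V)
    (μ : Measure (ℕ → E)) : Prop :=
  μ Set.univ = 1 ∧
  μ {γ | (∀ i : ℕ, G.dst (γ i) = G.src (γ (i + 1))) ∧ G.src (γ 0) = o ∧ Function.Bijective γ}
      = 1 ∧
  ∀ (n : ℕ) (w w' : Fin n → E), Function.Injective w → Function.Injective w' →
    Set.range w = Set.range w' → PrefixPath G o w → PrefixPath G o w' →
    ∀ B : Set (ℕ → E),
      μ {γ | (∀ i : Fin n, γ (i : ℕ) = w i) ∧ (fun t : ℕ => γ (n + t)) ∈ B} =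
        μ {γ | (∀ i : Fin n, γ (i : ℕ) = w' i) ∧ (fun t : ℕ => γ (n + t)) ∈ B}

/-! ### Loop erasure and Wilson's algorithm rooted at infinity -/

/-- The loop-erasure times of the (transient) vertex sequence `p`:
`t₀ = 0`, `tᵢ₊₁ = 1 + max {t ≥ tᵢ : p t = p tᵢ}`. -/
noncomputable def leTimes {V : Type} (p : ℕ → V) : ℕ → ℕ
  | 0 => 0
  | i + 1 => sSup {t : ℕ | leTimes p i ≤ t ∧ p t = p (leTimes p i)} + 1

/-- The loop-erasure times of the vertex sequence `p` run up to time `k`. -/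
noncomputable def leTimesF {V : Type} (p : ℕ → V) (k : ℕ) : ℕ → ℕ
  | 0 => 0
  | i + 1 => sSup {t : ℕ | leTimesF p k i ≤ t ∧ t ≤ k ∧ p t = p (leTimesF p k i)} + 1

/-- The set of vertices incident to an edge of `A`. -/
def vertsOf {V E : Type} (G : DigraphStruct V E) (A : Set E) : Set V :=
  {u | ∃ e ∈ A, G.src e = u ∨ G.dst e = u}

open Classical in
/-- The set of edges of the loop-erasure of the walk `x` (an edge sequence) stopped when it
first hits `U`; if it never hits `U`, the loop-erasure of the whole (transient) walk. -/
noncomputable def stoppedLEedges {V E : Type} (G : DigraphStruct V E) (U : Set V) (x : ℕ → E) :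
    Set E :=
  if ∃ t : ℕ, G.src (x t) ∈ U then
    {e | ∃ i : ℕ,
      leTimesF (fun t => G.src (x t)) (sInf {t : ℕ | G.src (x t) ∈ U}) i <
          sInf {t : ℕ | G.src (x t) ∈ U} ∧
        x (leTimesF (fun t => G.src (x t)) (sInf {t : ℕ | G.src (x t) ∈ U}) i) = e}
  else Set.range fun i => x (leTimes (fun t => G.src (x t)) i)

/-- The partial edge sets generated by Wilson's algorithm rooted at infinity, run with the
enumeration `v` of the vertices and with `W j` the random walk used at stage `j + 1`
(started at `v j`). -/
noncomputable def wilsonA {V E : Type} (G : DigraphStruct V E) (v : ℕ → V) (W : ℕ → ℕ → E) :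
    ℕ → Set E
  | 0 => ∅
  | j + 1 =>
      wilsonA G v W j ∪
        stoppedLEedges G (vertsOf G (wilsonA G v W j) ∪ {u | ∃ i < j, v i = u}) (W j)

open Classical in
/-- Cylinder probabilities for the random walk on `G` started at `v`, recorded as a sequence of
edges: the probability that the first `n` crossed edges are `x 0, …, x (n-1)`. -/
noncomputable def edgeWalkCyl {V E : Type} (G : DigraphStruct V E) (v : V) (x : ℕ → E) (n : ℕ) :
    ℝ≥0∞ :=
  if (0 < n → G.src (x 0) = v) ∧ (∀ i : ℕ, i + 1 < n → G.dst (x i) = G.src (x (i + 1))) then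
    ∏ i ∈ Finset.range n, ((G.outDeg (G.src (x i)) : ℝ≥0∞))⁻¹
  else 0

/-- `P` is the joint law of a sequence of independent random walks on `G`, the `j`-th walk
started at `v j`. -/
def IsIndepWalksLaw {V E : Type} [MeasurableSpace E] (G : DigraphStruct V E) (v : ℕ → V)
    (P : Measure (ℕ → ℕ → E)) : Prop :=
  P Set.univ = 1 ∧
    ∀ (m n : ℕ) (x : ℕ → ℕ → E),
      P {ω | ∀ j < m, ∀ t < n, ω j t = x j t} =
        ∏ j ∈ Finset.range m, edgeWalkCyl G (v j) (x j) n

/-- `μ` is the law of the random walk on `G` started at `o`, recorded as its sequence of crossed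
edges. -/
def IsEdgeWalkLaw {V E : Type} [MeasurableSpace E] (G : DigraphStruct V E) (o : V)
    (μ : Measure (ℕ → E)) : Prop :=
  μ Set.univ = 1 ∧ ∀ (n : ℕ) (x : ℕ → E), μ {ω | ∀ i < n, ω i = x i} = edgeWalkCyl G o x n

/-! ### Finite approximations and Gibbs measures on arboreta -/

/-- A finite digraph with vertices and edges labelled by natural numbers. -/
structure FinDigraph where
  VS : Finset ℕ
  ES : Finset ℕ
  fsrc : ℕ → ℕ
  fdst : ℕ → ℕ

/-- `B` is a spanning in-arborescence of the finite digraph `H` rooted at `z`. -/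
def FinDigraph.IsArb (H : FinDigraph) (z : ℕ) (B : Finset ℕ) : Prop :=
  B ⊆ H.ES ∧ (∀ e ∈ B, H.fsrc e ≠ z) ∧
  (∀ v ∈ H.VS, v ≠ z → ∃! e : ℕ, e ∈ B ∧ H.fsrc e = v) ∧
  (∀ v ∈ H.VS, Relation.ReflTransGen
      (fun a b => ∃ e ∈ B, H.fsrc e = a ∧ H.fdst e = b) v z)

/-- A finite digraph `H` with a distinguished vertex `z`, together with a partial isomorphism
to a digraph on `(V, E)`: vertex and edge domains `A`, `F` in `H` and maps `φV`, `φE` to `V`, `E`. -/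
structure PIso (V E : Type) where
  H : FinDigraph
  z : ℕ
  A : Finset ℕ
  F : Finset ℕ
  φV : ℕ → V
  φE : ℕ → E

/-- The data of `p` really is a partial isomorphism to `G`. -/
def PIso.Valid {V E : Type} (p : PIso V E) (G : DigraphStruct V E) : Prop :=
  ↑p.A ⊆ ↑p.H.VS ∧ ↑p.F ⊆ ↑p.H.ES ∧ p.z ∈ p.H.VS ∧
  Set.InjOn p.φV ↑p.A ∧ Set.InjOn p.φE ↑p.F ∧
  ∀ e ∈ p.F, p.H.fsrc e ∈ p.A ∧ p.H.fdst e ∈ p.A ∧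
    G.src (p.φE e) = p.φV (p.H.fsrc e) ∧ G.dst (p.φE e) = p.φV (p.H.fdst e)

/-- The partial isomorphism `p` identifies a neighbourhood of (a preimage of) `w`:
`w` is in the range of `φV` and `φE` maps the edges incident to its preimage bijectively onto
the edges incident to `w`. -/
def PIso.GoodAt {V E : Type} (p : PIso V E) (G : DigraphStruct V E) (w : V) : Prop :=
  ∃ w' ∈ p.A, p.φV w' = w ∧
    (∀ e' ∈ p.H.ES, (p.H.fsrc e' = w' ∨ p.H.fdst e' = w') → e' ∈ p.F) ∧
    ∀ e : E, (G.src e = w ∨ G.dst e = w) →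
      ∃! e' : ℕ, e' ∈ p.F ∧ (p.H.fsrc e' = w' ∨ p.H.fdst e' = w') ∧ p.φE e' = e

/-- `a` is a finite approximation to `G`: a sequence of finite digraphs with distinguished
vertices `zₙ` and partial isomorphisms to `G`, identifying larger and larger neighbourhoods of
every finite vertex set, with the distinguished vertices escaping to infinity. -/
def IsFinApproxSeq {V E : Type} (G : DigraphStruct V E) (a : ℕ → PIso V E) : Prop :=
  (∀ n, (a n).Valid G) ∧
  (∀ W : Finset V, ∃ N, ∀ n ≥ N, ∀ w ∈ W, (a n).GoodAt G w) ∧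
  (∀ W : Finset V, ∃ N, ∀ n ≥ N, ¬((a n).z ∈ (a n).A ∧ (a n).φV (a n).z ∈ (W : Set V)))

/-- The probability, under the uniform spanning in-arborescence of `p.H` rooted at `p.z`, that
every edge of `F` is in the image of the arborescence under the partial isomorphism. -/
noncomputable def pisoUACyl {V E : Type} (p : PIso V E) (F : Finset E) :
    ℝ≥0∞ :=
  (Nat.card {B : Finset ℕ // p.H.IsArb p.z B ∧ ∀ e ∈ F, ∃ e' ∈ B, e' ∈ p.F ∧ p.φE e' = e} :
      ℝ≥0∞) /
    (Nat.card {B : Finset ℕ // p.H.IsArb p.z B} : ℝ≥0∞)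

/-- `μ` (a measure on edge sets, encoded as elements of `E → Bool`) is a Gibbs measure on
spanning in-arboreta of `G` rooted at infinity: it is a weak limit of mixtures (over a random
finite approximation to `G`) of uniform spanning in-arborescence measures on finite
approximations to `G`. -/
def IsArbGibbs {V E : Type} (G : DigraphStruct V E) (μ : Measure (E → Bool)) : Prop :=
  μ Set.univ = 1 ∧
  ∃ (Ω : Type) (mΩ : MeasurableSpace Ω) (ν : @Measure Ω mΩ) (a : Ω → ℕ → PIso V E),
    ν Set.univ = 1 ∧ (∀ ω : Ω, IsFinApproxSeq G (a ω)) ∧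
    ∀ F : Finset E,
      Filter.Tendsto (fun n => ∫⁻ ω, pisoUACyl (a ω n) F ∂ν) Filter.atTop
        (nhds (μ {A : E → Bool | ∀ e ∈ F, A e = true}))

/-! ### Stacks -/

open Classical in
/-- The state (current vertex, remaining stacks) after `n` steps of following the stacks `σ`
starting from `o`: at each step we cross the edge at the front of the list at the current vertex
and delete it from the list (doing nothing if the list is empty). -/
noncomputable def stackState {V E : Type} (G : DigraphStruct V E) (o : V) (σ : V → List E) :
    ℕ → V × (V → List E)
  | 0 => (o, σ)
  | n + 1 =>
    let p := stackState G o σ n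
    match p.2 p.1 with
    | [] => p
    | e :: rest => (G.dst e, Function.update p.2 p.1 rest)

/-- The edge crossed at step `n` when following the stacks `σ` from `o` (`none` if the
current stack is exhausted). -/
noncomputable def stackEdge {V E : Type} (G : DigraphStruct V E) (o : V) (σ : V → List E)
    (n : ℕ) : Option E :=
  ((stackState G o σ n).2 (stackState G o σ n).1).head?

/-- The sigma-algebra on stack configurations. -/
noncomputable def stackMS (V E : Type) : MeasurableSpace (V → List E) :=
  @MeasurableSpace.pi V (fun _ => List E) fun _ => ⊤

open Classical in
/-- `ρ` is the law of the random stack configuration built from a random arboretum with law `κ`: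
place the arboretum edge at the bottom of the stack at each vertex, and an independent,
uniformly random ordering of the remaining outgoing edges on top of it. -/
def IsStackLaw {V E : Type} (G : DigraphStruct V E) (κ : Measure (E → Bool))
    (ρ : @Measure (V → List E) (stackMS V E)) : Prop :=
  ρ Set.univ = 1 ∧
    ∀ (K : Finset V) (s : V → List E),
      ρ {σ | ∀ v ∈ K, σ v = s v} =
        if ∀ v ∈ K, (s v).Nodup ∧ ∀ e : E, e ∈ s v ↔ G.src e = v then
          κ {A | ∀ v ∈ K, ∃ e : E, (s v).getLast? = some e ∧ A e = true} *
            ∏ v ∈ K, (((G.outDeg v - 1).factorial : ℝ≥0∞))⁻¹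
        else 0

/-! ### Markov chains -/

open Classical in
/-- `ν` is the law of the trajectory of a Markov chain with state space `S' ⊆ S`, transition
kernel `p` and deterministic initial state `s0`. -/
def IsMCLaw {S : Type} [MeasurableSpace S] (S' : Set S) (p : S → S → ℝ≥0∞) (s0 : S)
    (ν : Measure (ℕ → S)) : Prop :=
  ν Set.univ = 1 ∧ s0 ∈ S' ∧
  (∀ u ∈ S', (∑' v : S, p u v) = 1 ∧ ∀ v : S, p u v ≠ 0 → v ∈ S') ∧
  (∀ u : S, u ∉ S' → ∀ v : S, p u v = 0) ∧
  ∀ (n : ℕ) (y : ℕ → S),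
    ν {x | ∀ i ≤ n, x i = y i} =
      if y 0 = s0 then ∏ i ∈ Finset.range n, p (y i) (y (i + 1)) else 0

/-- `ν` is the law of the trajectory of a recurrent Markov chain on a subset of `S` with
non-random initial state: the chain returns to its initial state infinitely often a.s. -/
def IsRecMCLaw {S : Type} [MeasurableSpace S] (ν : Measure (ℕ → S)) : Prop :=
  ∃ (S' : Set S) (p : S → S → ℝ≥0∞) (s0 : S),
    IsMCLaw S' p s0 ν ∧ ν {x | {i : ℕ | x i = s0}.Infinite} = 1

/-- `ν` is the law of the sequence of vertices visited by (the unique) proper Gibbs measure on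
Eulerian paths from `o` to `∞` on a sourced Eulerian digraph whose vertex set is a subset
of `S`. -/
def IsGibbsVertexLaw {S : Type} [MeasurableSpace S] (ν : Measure (ℕ → S)) : Prop :=
  ∃ (Vs : Set S) (E : Type) (mE : MeasurableSpace E) (G : DigraphStruct (↥Vs) E) (o : ↥Vs),
    Countable E ∧ G.IsSourcedEulerian o ∧
    ∃ μp : @Measure (ℕ → E) (@MeasurableSpace.pi ℕ (fun _ => E) fun _ => mE),
      @ProperGibbs (↥Vs) E mE G o μp ∧
      ∀ A : Set (ℕ → S), MeasurableSet A →
        ν A = μp ((fun (γ : ℕ → E) (i : ℕ) => ((G.src (γ i) : S))) ⁻¹' A)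

/-- Concatenation of a finite list with an infinite sequence. -/
def concatSeq {S : Type} (l : List S) (y : ℕ → S) : ℕ → S :=
  fun i => if h : i < l.length then l.get ⟨i, h⟩ else y (i - l.length)

/-- `ν` is the law of a process following a uniform random Eulerian path on a finite Eulerian
digraph with source and sink whose vertex set is a subset of `S`, followed by the trajectory of
an (independent) recurrent Markov chain on a disjoint subset of `S` with non-random initial
state. -/
def IsMixedLaw {S : Type} [MeasurableSpace S] (ν : Measure (ℕ → S)) : Prop :=
  ∃ (Vf : Finset S) (Ef : Type) (_ : Finite Ef)
    (Gf : DigraphStruct {s : S // s ∈ Vf} Ef) (of zf : {s : S // s ∈ Vf})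
    (Vr : Set S) (p : S → S → ℝ≥0∞) (s1 : S) (νMC : Measure (ℕ → S)),
    IsFinEulerian Gf of zf ∧ Disjoint (↑Vf : Set S) Vr ∧
    IsMCLaw Vr p s1 νMC ∧ νMC {x | {i : ℕ | x i = s1}.Infinite} = 1 ∧
    ∀ A : Set (ℕ → S), MeasurableSet A →
      ν A =
        (∑' L : {L : List Ef // IsEulerList Gf of zf L},
            νMC ((fun y => concatSeq (((of : S)) ::
              (L : List Ef).map fun e => ((Gf.dst e : S))) y) ⁻¹' A)) /
          (Nat.card {L : List Ef // IsEulerList Gf of zf L} : ℝ≥0∞)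

/-! ### Lists of edges and stacks -/

section Lists

theorem rtg_closed {A : Type} {r : A → A → Prop} {P : A → Prop} {a b : A}
    (h : Relation.ReflTransGen r a b) (hP : ∀ x y, P x → r x y → P y) (ha : P a) : P b := by
  induction h with
  | refl => exact ha
  | tail _ hs ih => exact hP _ _ ih hs

variable {V E : Type} (G : DigraphStruct V E)

open Classical in
/-- The stack at `v` of a word: the edges out of `v`, in the order of appearance. -/
noncomputable def stk (v : V) (w : List E) : List E := w.filter (fun e => decide (G.src e = v))

theorem stk_nil (v : V) : stk G v [] = [] := by simp [stk]

theorem stk_cons_eq {v : V} {e : E} (h : G.src e = v) (w : List E) :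
    stk G v (e :: w) = e :: stk G v w := by simp [stk, h]

theorem stk_cons_ne {v : V} {e : E} (h : G.src e ≠ v) (w : List E) :
    stk G v (e :: w) = stk G v w := by simp [stk, h]

theorem mem_stk {v : V} {e : E} {w : List E} : e ∈ stk G v w ↔ e ∈ w ∧ G.src e = v := by
  simp [stk]

theorem stk_append (v : V) (w w' : List E) : stk G v (w ++ w') = stk G v w ++ stk G v w' := by
  simp [stk]

theorem stk_perm (v : V) {w w' : List E} (h : w.Perm w') : (stk G v w).Perm (stk G v w') :=
  h.filter _

theorem stk_pref_mono (v : V) {w w' : List E} (h : w <+: w') : stk G v w <+: stk G v w' :=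
  h.filter _

theorem prefix_of_stk : ∀ (w₀ w : List E) (o z z' : V), IsPathList G o z w₀ → IsPathList G o z' w →
    (∀ v, stk G v w₀ <+: stk G v w) → w₀ <+: w := by
  intro w₀
  induction w₀ with
  | nil => intro w _ _ _ _ _ _; exact ⟨_, rfl⟩
  | cons e w₀ ih =>
    intro w o z z' h₀ h hp
    obtain ⟨he, h₀⟩ := h₀
    cases w with
    | nil =>
      have := hp o
      rw [stk_cons_eq G he, stk_nil] at this
      simp at this
    | cons f w =>
      obtain ⟨hf, h⟩ := h
      have h1 := hp o
      rw [stk_cons_eq G he, stk_cons_eq G hf, List.cons_prefix_cons] at h1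
      obtain ⟨rfl, h1⟩ := h1
      rw [List.cons_prefix_cons]
      refine ⟨rfl, ih w _ z z' h₀ h ?_⟩
      intro v
      have h2 := hp v
      by_cases hv : G.src e = v
      · rw [stk_cons_eq G hv, stk_cons_eq G hv, List.cons_prefix_cons] at h2
        exact h2.2
      · rwa [stk_cons_ne G hv, stk_cons_ne G hv] at h2

theorem eq_of_stk {w w' : List E} {o z z' : V} (h : IsPathList G o z w)
    (h' : IsPathList G o z' w') (hs : ∀ v, stk G v w = stk G v w') : w = w' := by
  have h1 := prefix_of_stk G w w' o z z' h h' (fun v => by rw [hs v])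
  have h2 := prefix_of_stk G w' w o z' z h' h (fun v => by rw [hs v])
  exact h1.eq_of_length (le_antisymm h1.length_le h2.length_le)

open Classical in
theorem stack_path_exists : ∀ (n : ℕ) (R : List E), R.length = n → ∀ (o : V) (σ : V → List E),
    (∀ v, (σ v).Perm (stk G v R)) →
    ∃ (w : List E) (z : V) (rest : V → List E), IsPathList G o z w ∧
      (∀ v, stk G v w ++ rest v = σ v) ∧ rest z = [] := by
  intro n
  induction n with
  | zero =>
    intro R hR o σ hσ
    refine ⟨[], o, σ, rfl, fun v => by simp [stk_nil], ?_⟩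
    have := hσ o
    rw [List.length_eq_zero_iff.1 hR, stk_nil] at this
    exact this.eq_nil
  | succ n ih =>
    intro R hR o σ hσ
    cases hσo : σ o with
    | nil => exact ⟨[], o, σ, rfl, fun v => by simp [stk_nil], hσo⟩
    | cons e r =>
      have he : e ∈ stk G o R := (hσ o).subset (by simp [hσo])
      rw [mem_stk] at he
      obtain ⟨heR, heo⟩ := he
      have hp := List.perm_cons_erase heR
      obtain ⟨w, z, rest, hw, hst, hz⟩ := ih (R.erase e)
        (by rw [List.length_erase_of_mem heR, hR]; rfl) (G.dst e) (Function.update σ o r) (by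
          intro v
          have h1 := (hσ v).trans (stk_perm G v hp)
          by_cases hv : v = o
          · subst hv
            rw [hσo, stk_cons_eq G heo] at h1
            simpa using h1.cons_inv
          · rw [stk_cons_ne G (by rw [heo]; exact fun h => hv h.symm)] at h1
            simpa [hv] using h1)
      refine ⟨e :: w, z, rest, ⟨heo, hw⟩, ?_, hz⟩
      intro v
      have h2 := hst v
      by_cases hv : v = o
      · subst hv
        rw [stk_cons_eq G heo, hσo]
        simpa using h2
      · rw [stk_cons_ne G (by rw [heo]; exact fun h => hv h.symm)]
        simpa [hv] using h2

open Classical in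
theorem path_balance : ∀ (w : List E) (o z : V), IsPathList G o z w → ∀ x : V,
    w.countP (fun e => decide (G.dst e = x)) + (if x = o then 1 else 0) =
      (stk G x w).length + (if x = z then 1 else 0) := by
  intro w
  induction w with
  | nil => intro o z h x; have h : o = z := h; subst h; simp [stk_nil]
  | cons e w ih =>
    intro o z h x
    obtain ⟨he, h⟩ := h
    have := ih _ _ h x
    rw [List.countP_cons]
    by_cases hx : x = o
    · subst hx
      rw [stk_cons_eq G he, List.length_cons]
      simp only [decide_eq_true_eq, eq_comm (a := x) (b := G.dst e)] at this ⊢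
      simp only [if_true]
      omega
    · rw [stk_cons_ne G (by rw [he]; exact fun h => hx h.symm)]
      simp only [decide_eq_true_eq, eq_comm (a := x) (b := G.dst e)] at this ⊢
      simp only [hx, if_false]
      omega

open Classical in
theorem best_lemma {w : List E} {o z : V} (hw : IsPathList G o z w) (σ : V → List E)
    (hσ : ∀ v, (σ v).Perm (stk G v w))
    (hl : ∀ Q : Set V, Q.Nonempty → z ∉ Q → (∀ v ∈ Q, σ v ≠ []) →
      ∃ v ∈ Q, ∀ e ∈ (σ v).getLast?, G.dst e ∉ Q) :
    ∃ w', IsPathList G o z w' ∧ w'.Perm w ∧ ∀ v, stk G v w' = σ v := by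
  obtain ⟨w', z', rest, hw', hst, hz'⟩ := stack_path_exists G _ w rfl o σ hσ
  have hcount : ∀ (l : List E) (e : E), l.count e = (stk G (G.src e) l).count e := by
    intro l e
    rw [stk, List.count_filter (by simp)]
  have hsub : ∀ e ∈ w', w'.count e ≤ w.count e := by
    intro e _
    rw [hcount w', hcount w, ← (hσ _).count_eq, ← hst, List.count_append]
    omega
  have hperm := List.subperm_append_diff_self_of_count_le hsub
  set u := w.diff w' with hu
  have hrest : ∀ v, (rest v).Perm (stk G v u) := by
    intro v
    have h1 := (stk_perm G v hperm).trans (hσ v).symm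
    rw [stk_append, ← hst] at h1
    exact ((List.perm_append_left_iff _).1 h1).symm
  have hb : ∀ x : V, u.countP (fun e => decide (G.dst e = x)) + (if x = z' then 1 else 0) =
      (stk G x u).length + (if x = z then 1 else 0) := by
    intro x
    have h1 := path_balance G w o z hw x
    have h2 := path_balance G w' o z' hw' x
    have h3 := (stk_perm G x hperm).length_eq
    have h4 := hperm.countP_eq (fun e => decide (G.dst e = x))
    rw [stk_append, List.length_append] at h3
    rw [List.countP_append] at h4
    omega
  have hzz : z' = z := by
    by_contra hne
    have h1 := hb z'
    have h2 := (hrest z').length_eq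
    rw [hz'] at h2
    simp [hne] at h1 h2
    omega
  subst hzz
  have hQ : ∀ v, rest v = [] := by
    by_contra hcon
    push Not at hcon
    obtain ⟨v₀, hv₀⟩ := hcon
    obtain ⟨v, hv, hve⟩ := hl {v | rest v ≠ []} ⟨v₀, hv₀⟩ (by simpa using hz') (by
      intro v hv h
      rw [← hst] at h
      exact hv (List.append_eq_nil_iff.1 h).2)
    have hv : rest v ≠ [] := hv
    have hlast : (σ v).getLast? = some ((rest v).getLast hv) := by
      rw [← hst, List.getLast?_append_of_ne_nil _ hv, List.getLast?_eq_getLast_of_ne_nil hv]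
    have h1 := hve _ hlast
    apply h1
    intro h2
    have hmem : (rest v).getLast hv ∈ u :=
      ((mem_stk G).1 ((hrest v).subset (List.getLast_mem hv))).1
    have h3 := hb (G.dst ((rest v).getLast hv))
    have h4 := (hrest (G.dst ((rest v).getLast hv))).length_eq
    rw [h2] at h4
    have h5 : 0 < u.countP (fun e => decide (G.dst e = G.dst ((rest v).getLast hv))) :=
      List.countP_pos_iff.2 ⟨_, hmem, by simp⟩
    simp only [List.length_nil] at h4
    omega
  have hu0 : u = [] := by
    rw [List.eq_nil_iff_forall_not_mem]
    intro e he
    have h1 : e ∈ stk G (G.src e) u := (mem_stk G).2 ⟨he, rfl⟩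
    have h2 := (hrest (G.src e)).symm.subset h1
    rw [hQ] at h2
    simp at h2
  refine ⟨w', hw', ?_, ?_⟩
  · rw [hu0, List.append_nil] at hperm
    exact hperm
  · intro v
    rw [← hst v, hQ v, List.append_nil]

/-- One step along the last-exit edges of the word. -/
def tstep (w : List E) (u v : V) : Prop := ∃ e, (stk G u w).getLast? = some e ∧ G.dst e = v

theorem reach_end : ∀ (w : List E) (o z : V), IsPathList G o z w → ∀ v, stk G v w ≠ [] →
    Relation.ReflTransGen (tstep G w) v z := by
  intro w
  induction w with
  | nil => intro o z _ v hv; exact absurd (stk_nil G v) hv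
  | cons e w ih =>
    intro o z h v hv
    obtain ⟨he, h⟩ := h
    have hmono : ∀ a b, tstep G w a b → tstep G (e :: w) a b := by
      rintro a b ⟨f, hf, hb⟩
      refine ⟨f, ?_, hb⟩
      by_cases ha : G.src e = a
      · rw [stk_cons_eq G ha, List.getLast?_cons, hf]; rfl
      · rw [stk_cons_ne G ha, hf]
    by_cases hv' : stk G v w = []
    · have hev : G.src e = v := by
        by_contra hne
        rw [stk_cons_ne G hne] at hv
        exact hv hv'
      have hs : tstep G (e :: w) v (G.dst e) := ⟨e, by rw [stk_cons_eq G hev, hv']; rfl, rfl⟩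
      refine Relation.ReflTransGen.head hs ?_
      cases w with
      | nil => have h : G.dst e = z := h; rw [h]
      | cons f w =>
        refine Relation.ReflTransGen.mono hmono _ _ (ih _ _ h (G.dst e) ?_)
        rw [stk_cons_eq G h.1]
        simp
    · exact Relation.ReflTransGen.mono hmono _ _ (ih _ _ h v hv')

/-- The set of vertices whose past in the last-exit graph of the word is saturated. -/
def satSet (w : List E) : Set V :=
  {v | ∀ u, Relation.ReflTransGen (tstep G w) u v → ∀ e, G.src e = u → e ∈ w}

/-- A good word: a path from `o` with no repeated edge, whose endpoint is not saturated. -/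
def GoodWord (o : V) (w : List E) : Prop :=
  ∃ z, IsPathList G o z w ∧ w.Nodup ∧ ∃ e, G.src e = z ∧ e ∉ w

/-- Target of the last edge of a list. -/
def tgt (o : V) (l : List E) : V := ((l.getLast?).map G.dst).getD o

/-- No nonempty subset of `U` is closed under `f`. -/
def Exits (U : Finset V) (f : U → V) : Prop :=
  ∀ Q : Set V, Q.Nonempty → Q ⊆ U → ∃ v : U, (v : V) ∈ Q ∧ f v ∉ Q

/-- An ordering of the edges out of `v`. -/
def IsOrd (v : V) (l : List E) : Prop := l.Nodup ∧ ∀ e, e ∈ l ↔ G.src e = v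

theorem tgt_eq {o : V} {l : List E} {e : E} (h : l.getLast? = some e) :
    tgt G o l = G.dst e := by simp [tgt, h]

theorem satSet_isOrd {w : List E} (hn : w.Nodup) {v : V} (hv : v ∈ satSet G w) :
    IsOrd G v (stk G v w) := by
  refine ⟨hn.filter _, fun e => ?_⟩
  rw [mem_stk]
  exact ⟨fun h => h.2, fun h => ⟨hv v .refl e h, h⟩⟩

theorem satSet_closed {w : List E} {u v : V} (hv : v ∈ satSet G w) (h : tstep G w u v) :
    u ∈ satSet G w := fun x hx => hv x (hx.tail h)

theorem satSet_exits (hout : ∀ v, ∃ e, G.src e = v) {o : V} {w : List E} (hw : GoodWord G o w)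
    {U : Finset V} (hU : satSet G w = U) : Exits U (fun v => tgt G o (stk G v w)) := by
  obtain ⟨z, hp, hn, e, hez, hew⟩ := hw
  rintro Q ⟨v, hv⟩ hQU
  by_contra hcon
  push Not at hcon
  have hvU : v ∈ satSet G w := by rw [hU]; exact hQU hv
  have hzQ : z ∈ Q := by
    have hr := reach_end G w o z hp v (by
      obtain ⟨f, hf⟩ := hout v
      intro h
      have := ((satSet_isOrd G hn hvU).2 f).2 hf
      rw [h] at this
      simp at this)
    refine rtg_closed (P := fun x => x ∈ Q) hr ?_ hv
    rintro b c ih ⟨f, hf, rfl⟩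
    have := hcon ⟨b, hQU ih⟩ ih
    rwa [tgt_eq G hf] at this
  have hzU : z ∈ satSet G w := by rw [hU]; exact hQU hzQ
  exact hew (hzU z .refl e hez)

open Classical in
theorem transport {o : V} {w : List E} (hw : GoodWord G o w)
    {U : Finset V} (hU : satSet G w = U) (s : U → List E) (hs : ∀ v : U, IsOrd G v (s v))
    (hex : Exits U (fun v => tgt G o (s v))) :
    ∃ w', GoodWord G o w' ∧ w'.Perm w ∧ satSet G w' = U ∧ (∀ v : U, stk G v w' = s v) ∧
      ∀ v, v ∉ U → stk G v w' = stk G v w := by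
  obtain ⟨z, hp, hn, e, hez, hew⟩ := hw
  have hzU : z ∉ U := by
    intro h
    have hzU : z ∈ satSet G w := by rw [hU]; exact h
    exact hew (hzU z .refl e hez)
  let σ : V → List E := fun v => if h : v ∈ U then s ⟨v, h⟩ else stk G v w
  have hσU : ∀ v (h : v ∈ U), σ v = s ⟨v, h⟩ := fun v h => by simp [σ, h]
  have hσn : ∀ v, v ∉ U → σ v = stk G v w := fun v h => by simp [σ, h]
  have hfw : ∀ u v, u ∉ U → tstep G w u v → v ∉ U := by
    intro u v hu h hv
    apply hu
    have hv : v ∈ satSet G w := by rw [hU]; exact hv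
    have := satSet_closed G hv h
    rwa [hU] at this
  obtain ⟨w', hp', hperm, hst⟩ := best_lemma G hp σ (by
    intro v
    by_cases hv : v ∈ U
    · rw [hσU v hv]
      have hvs : v ∈ satSet G w := by rw [hU]; exact hv
      have h1 := satSet_isOrd G hn hvs
      rw [List.perm_ext_iff_of_nodup (hs ⟨v, hv⟩).1 h1.1]
      intro a
      rw [(hs ⟨v, hv⟩).2, h1.2]
    · rw [hσn v hv]) (by
    intro Q hQ hzQ hne
    by_cases hQU : Q ⊆ U
    · obtain ⟨v, hv, hvQ⟩ := hex Q hQ hQU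
      refine ⟨v, hv, fun f hf => ?_⟩
      rw [hσU v v.2] at hf
      rwa [← tgt_eq G (o := o) hf]
    · rw [Set.not_subset] at hQU
      obtain ⟨v, hv, hvU⟩ := hQU
      have hvU : v ∉ U := hvU
      by_contra hcon
      push Not at hcon
      have hne' := hne v hv
      rw [hσn v hvU] at hne'
      have hr := reach_end G w o z hp v hne'
      have : z ∈ Q ∧ z ∉ U := by
        refine rtg_closed (P := fun x => x ∈ Q ∧ x ∉ U) hr ?_ ⟨hv, hvU⟩
        intro b c ih hs
        have hc := hfw b c ih.2 hs
        obtain ⟨f, hf, rfl⟩ := hs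
        obtain ⟨f', hf', hfQ⟩ := hcon b ih.1
        rw [hσn b ih.2, hf] at hf'
        cases hf'
        exact ⟨hfQ, hc⟩
      exact hzQ this.1)
  have hstn : ∀ v, v ∉ U → stk G v w' = stk G v w := fun v hv => by rw [hst, hσn v hv]
  have htn : ∀ u v, u ∉ U → (tstep G w' u v ↔ tstep G w u v) := by
    intro u v hu
    simp only [tstep, hstn u hu]
  refine ⟨w', ⟨z, hp', hperm.nodup_iff.2 hn, e, hez, fun h => hew (hperm.subset h)⟩, hperm, ?_,
    fun v => by rw [hst, hσU v v.2], hstn⟩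
  ext v
  constructor
  · intro hv
    by_contra hvU
    have hvU : v ∉ U := hvU
    have hvs : v ∉ satSet G w := by rw [hU]; exact hvU
    simp only [satSet, Set.mem_ofPred_eq, not_forall] at hvs
    obtain ⟨u, hu, f, hf, hfw'⟩ := hvs
    apply hfw'
    apply hperm.subset
    refine hv u ?_ f hf
    have huU : u ∉ U := by
      intro h
      have h : u ∈ satSet G w := by rw [hU]; exact h
      exact hfw' (h u .refl f hf)
    have : Relation.ReflTransGen (tstep G w') u v ∧ v ∉ U := by
      refine rtg_closed (P := fun x => Relation.ReflTransGen (tstep G w') u x ∧ x ∉ U) hu ?_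
        ⟨.refl, huU⟩
      intro b c ih hs
      exact ⟨ih.1.tail ((htn _ _ ih.2).2 hs), hfw _ _ ih.2 hs⟩
    exact this.1
  · intro hv u hu f hf
    have : u ∈ U := by
      clear hf
      induction hu using Relation.ReflTransGen.head_induction_on with
      | refl => exact hv
      | head hs _ ih =>
        by_contra hn'
        exact hfw _ _ hn' ((htn _ _ hn').1 hs) ih
    have hus : u ∈ satSet G w := by rw [hU]; exact this
    exact hperm.symm.subset (hus u .refl f hf)

end Lists

/-! ### Matrix tree theorem and Green functions -/

section MatrixTree

variable {V E ι : Type}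

open Classical in
theorem det_one_sub (U : Finset V) (f : U → V) :
    (Matrix.of fun v w : U => ((if v = w then 1 else 0) - if f v = (w : V) then 1 else 0 : ℝ)).det =
      if Exits U f then 1 else 0 := by
  let F : V → V := fun v => if h : v ∈ U then f ⟨v, h⟩ else v
  have hF : ∀ v : U, F v = f v := fun v => by simp [F]
  split_ifs with hex
  · have hk : ∀ v : V, ∃ k, F^[k] v ∉ U := by
      by_contra hcon
      push Not at hcon
      obtain ⟨v₀, hv₀⟩ := hcon
      obtain ⟨v, hv, hv'⟩ := hex {v | ∀ k, F^[k] v ∈ U} ⟨v₀, hv₀⟩ (fun v hv => hv 0)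
      apply hv'
      intro k
      have := hv (k + 1)
      rwa [Function.iterate_succ_apply, hF] at this
    let b : V → ℕ := fun v => Nat.find (hk v)
    have hb : ∀ v : U, b (f v) < b v := by
      intro v
      have h1 : F^[b v] v ∉ U := Nat.find_spec (hk v)
      cases hbv : b v with
      | zero => rw [hbv] at h1; exact absurd v.2 h1
      | succ k =>
        rw [hbv, Function.iterate_succ_apply, hF] at h1
        exact Nat.lt_succ_of_le (Nat.find_min' (hk (f v)) h1)
    have htri : (Matrix.of fun v w : U =>
        ((if v = w then 1 else 0) - if f v = (w : V) then 1 else 0 : ℝ)).BlockTriangular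
        (fun v => OrderDual.toDual (b v)) := by
      intro i j hij
      have hij : b i < b j := hij
      have h1 : i ≠ j := by rintro rfl; exact lt_irrefl _ hij
      have h2 : f i ≠ j := by intro h; have := hb i; rw [h] at this; omega
      simp [h1, h2]
    rw [htri.det]
    apply Finset.prod_eq_one
    intro a _
    have : Matrix.toSquareBlock (Matrix.of fun v w : U =>
        ((if v = w then 1 else 0) - if f v = (w : V) then 1 else 0 : ℝ))
        (fun v => OrderDual.toDual (b v)) a = 1 := by
      ext i j
      have h2 : f i.1 ≠ j.1 := by
        intro h
        have h3 := hb i.1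
        rw [h] at h3
        have h4 : b i.1 = b j.1 := OrderDual.toDual_inj.1 (i.2.trans j.2.symm)
        omega
      rw [Matrix.toSquareBlock_def, Matrix.of_apply, Matrix.of_apply, if_neg h2, sub_zero,
        Matrix.one_apply]
      by_cases hij : i = j
      · rw [if_pos hij, if_pos (congrArg _ hij)]
      · rw [if_neg hij, if_neg (fun h => hij (Subtype.ext h))]
    rw [this, Matrix.det_one]
  · unfold Exits at hex
    push Not at hex
    obtain ⟨Q, ⟨q, hq⟩, hQU, hQ⟩ := hex
    let S : Set V := {v | ∀ k, F^[k] v ∈ U}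
    have hqS : q ∈ S := by
      have : ∀ k, F^[k] q ∈ Q := by
        intro k
        induction k with
        | zero => exact hq
        | succ k ih =>
          rw [Function.iterate_succ_apply']
          have := hQ ⟨_, hQU ih⟩ ih
          rwa [← hF] at this
      exact fun k => hQU (this k)
    apply Matrix.exists_mulVec_eq_zero_iff.1
    refine ⟨fun v => if (v : V) ∈ S then 1 else 0, ?_, ?_⟩
    · intro h
      have := congrFun h ⟨q, hQU hq⟩
      simp [hqS] at this
    · ext v
      have hiff : f v ∈ S ↔ (v : V) ∈ S := by
        constructor
        · intro h k
          cases k with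
          | zero => exact v.2
          | succ k => rw [Function.iterate_succ_apply, hF]; exact h k
        · intro h k
          have := h (k + 1)
          rwa [Function.iterate_succ_apply, hF] at this
      have hSU : ∀ x, x ∈ S → x ∈ U := fun x hx => hx 0
      simp only [Matrix.mulVec, dotProduct, Matrix.of_apply, sub_mul, Finset.sum_sub_distrib]
      have h1 : ∑ x : U, (if v = x then (1 : ℝ) else 0) * (if (x : V) ∈ S then 1 else 0) =
          if (v : V) ∈ S then 1 else 0 := by
        rw [Finset.sum_eq_single v]
        · rw [if_pos rfl, one_mul]
        · intro y _ hy
          rw [if_neg (Ne.symm hy), zero_mul]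
        · intro h
          exact absurd (Finset.mem_univ _) h
      have h2 : ∑ x : U, (if f v = (x : V) then (1 : ℝ) else 0) * (if (x : V) ∈ S then 1 else 0) =
          if f v ∈ S then 1 else 0 := by
        by_cases hv : f v ∈ U
        · rw [Finset.sum_eq_single ⟨f v, hv⟩]
          · simp
          · intro y _ hy
            have : f v ≠ y := fun h => hy (Subtype.ext h.symm)
            simp [this]
          · simp
        · rw [if_neg (fun h => hv (hSU _ h))]
          apply Finset.sum_eq_zero
          intro y _
          have : f v ≠ y := fun h => hv (h ▸ y.2)
          simp [this]
      rw [h1, h2]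
      simp [hiff]

open Classical in
/-- Generalized Laplacian. -/
noncomputable def rowMat (U : Finset V) (Ω : V → Finset ι) (t : ι → V) : Matrix U U ℝ :=
  Matrix.of fun v w : U =>
    ∑ ω ∈ Ω v, ((if v = w then 1 else 0) - if t ω = (w : V) then 1 else 0)

open Classical in
/-- The admissible choices. -/
noncomputable def validSet (U : Finset V) (Ω : V → Finset ι) (t : ι → V) : Finset (U → ι) :=
  (Fintype.piFinset (fun v : U => Ω v)).filter (fun s => Exits U (fun v => t (s v)))

open Classical in
theorem matrix_tree (U : Finset V) (Ω : V → Finset ι) (t : ι → V) :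
    (rowMat U Ω t).det = (validSet U Ω t).card := by
  have h := (Matrix.detRowAlternating (R := ℝ) (n := U)).toMultilinearMap.map_sum_finset
    (fun (v : U) (ω : ι) => fun w : U =>
      ((if v = w then 1 else 0) - if t ω = (w : V) then 1 else 0 : ℝ)) (fun v => Ω v)
  have h1 : (rowMat U Ω t).det = (Matrix.detRowAlternating (R := ℝ) (n := U)).toMultilinearMap
      (fun v : U => ∑ ω ∈ Ω v, fun w : U =>
        ((if v = w then 1 else 0) - if t ω = (w : V) then 1 else 0 : ℝ)) := by
    show Matrix.det _ = Matrix.det _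
    congr 1
    ext v w
    simp [rowMat]
  rw [h1, h, validSet, Finset.card_filter]
  push_cast
  apply Finset.sum_congr rfl
  intro s _
  exact det_one_sub U (fun v => t (s v))

open Classical in
theorem rowMat_mul_sum (U : Finset V) (Ω : V → Finset ι) (t : ι → V) (f : V → ℝ)
    (hf : ∀ v, v ∉ U → f v = 0) (v : U) :
    ∑ w : U, rowMat U Ω t v w * f w = ∑ ω ∈ Ω v, (f v - f (t ω)) := by
  have hone : ∀ x : V, ∑ w : U, (if x = (w : V) then (1 : ℝ) else 0) * f w = f x := by
    intro x
    by_cases hx : x ∈ U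
    · rw [Finset.sum_eq_single ⟨x, hx⟩]
      · simp
      · intro y _ hy
        have : x ≠ y := fun h => hy (Subtype.ext h.symm)
        simp [this]
      · simp
    · rw [hf x hx]
      apply Finset.sum_eq_zero
      intro y _
      have : x ≠ y := fun h => hx (h ▸ y.2)
      simp [this]
  simp only [rowMat, Matrix.of_apply, Finset.sum_mul]
  rw [Finset.sum_comm]
  apply Finset.sum_congr rfl
  intro ω _
  simp only [sub_mul, Finset.sum_sub_distrib, hone]
  congr 1
  rw [Finset.sum_eq_single v]
  · rw [if_pos rfl, one_mul]
  · intro y _ hy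
    rw [if_neg (Ne.symm hy), zero_mul]
  · intro h
    exact absurd (Finset.mem_univ _) h

end MatrixTree

section Green

variable {V E : Type} (G : DigraphStruct V E) (out : V → Finset E)

/-- Maximum principle. -/
theorem max_principle (hout : ∀ v e, e ∈ out v ↔ G.src e = v)
    (hesc : ∀ Q : Set V, Q.Finite → Q.Nonempty → ∃ e, G.src e ∈ Q ∧ G.dst e ∉ Q)
    (U : Finset V) (f : V → ℝ) (h1 : ∀ v ∈ U, 0 ≤ ∑ e ∈ out v, (f v - f (G.dst e)))
    (h2 : ∀ v, v ∉ U → 0 ≤ f v) (v : V) : 0 ≤ f v := by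
  by_contra hv
  push Not at hv
  have hvU : v ∈ U := by by_contra h; exact absurd (h2 v h) (not_le.2 hv)
  obtain ⟨m, hmU, hm⟩ := U.exists_min_image f ⟨v, hvU⟩
  have hm0 : f m < 0 := (hm v hvU).trans_lt hv
  have hall : ∀ x, f m ≤ f x := by
    intro x
    by_cases hx : x ∈ U
    · exact hm x hx
    · exact hm0.le.trans (h2 x hx)
  obtain ⟨e, he, he'⟩ := hesc {x | x ∈ U ∧ f x = f m}
    (U.finite_toSet.subset (fun x hx => hx.1)) ⟨m, hmU, rfl⟩
  apply he'
  have hsum := h1 _ he.1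
  have hx : f (G.src e) = f m := he.2
  have hle : ∀ e' ∈ out (G.src e), f (G.src e) - f (G.dst e') ≤ 0 := by
    intro e' _
    have := hall (G.dst e')
    linarith
  have hz := (Finset.sum_eq_zero_iff_of_nonpos hle).1
    (le_antisymm (Finset.sum_nonpos hle) hsum) e ((hout _ _).2 rfl)
  have heq : f (G.dst e) = f m := by linarith
  refine ⟨?_, heq⟩
  by_contra h
  have := h2 _ h
  linarith

open Classical in
theorem lap_det_ne_zero (hout : ∀ v e, e ∈ out v ↔ G.src e = v)
    (hesc : ∀ Q : Set V, Q.Finite → Q.Nonempty → ∃ e, G.src e ∈ Q ∧ G.dst e ∉ Q)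
    (U : Finset V) : (rowMat U out G.dst).det ≠ 0 := by
  intro h
  obtain ⟨x, hx0, hx⟩ := Matrix.exists_mulVec_eq_zero_iff.2 h
  let f : V → ℝ := fun v => if h : v ∈ U then x ⟨v, h⟩ else 0
  have hfU : ∀ v : U, f v = x v := fun v => by simp [f]
  have hfn : ∀ v, v ∉ U → f v = 0 := fun v hv => by simp [f, hv]
  have hs : ∀ v (hv : v ∈ U), ∑ e ∈ out v, (f v - f (G.dst e)) = 0 := by
    intro v hv
    have h1 := rowMat_mul_sum U out G.dst f hfn ⟨v, hv⟩
    rw [← h1]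
    have h2 := congrFun hx ⟨v, hv⟩
    simp only [Matrix.mulVec, dotProduct, Pi.zero_apply] at h2
    rw [← h2]
    apply Finset.sum_congr rfl
    intro w _
    rw [hfU]
  have hpos := max_principle G out hout hesc U f (fun v hv => (hs v hv).ge)
    (fun v hv => (hfn v hv).ge)
  have hneg := max_principle G out hout hesc U (fun v => - f v) (fun v hv => by
    have h1 : ∑ e ∈ out v, (-f v - -f (G.dst e)) = - ∑ e ∈ out v, (f v - f (G.dst e)) := by
      rw [← Finset.sum_neg_distrib]
      apply Finset.sum_congr rfl
      intro e _
      ring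
    rw [h1, hs v hv]; simp) (fun v hv => by simp [hfn v hv])
  apply hx0
  ext v
  rw [← hfU]
  have := hpos v
  have := hneg v
  simp only [Pi.zero_apply]
  linarith

open Classical in
/-- The Green function of the walk killed outside `U` (divided by the degree). -/
noncomputable def gr (U : Finset V) (x w : V) : ℝ :=
  if h : x ∈ U ∧ w ∈ U then (rowMat U out G.dst)⁻¹ ⟨x, h.1⟩ ⟨w, h.2⟩ else 0

theorem gr_left_zero {U : Finset V} {x w : V} (h : x ∉ U) : gr G out U x w = 0 := by
  simp [gr, h]

theorem gr_right_zero {U : Finset V} {x w : V} (h : w ∉ U) : gr G out U x w = 0 := by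
  simp [gr, h]

theorem gr_coe {U : Finset V} (x w : U) :
    gr G out U x w = (open Classical in (rowMat U out G.dst)⁻¹) x w := by
  simp [gr]

open Classical in
theorem gr_eq (hout : ∀ v e, e ∈ out v ↔ G.src e = v)
    (hesc : ∀ Q : Set V, Q.Finite → Q.Nonempty → ∃ e, G.src e ∈ Q ∧ G.dst e ∉ Q)
    {U : Finset V} {v w : V} (hv : v ∈ U) (hw : w ∈ U) :
    ∑ e ∈ out v, (gr G out U v w - gr G out U (G.dst e) w) = if v = w then 1 else 0 := by
  have h1 := rowMat_mul_sum U out G.dst (fun x => gr G out U x w)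
    (fun x hx => gr_left_zero G out hx) ⟨v, hv⟩
  rw [← h1]
  have h2 := Matrix.mul_nonsing_inv (rowMat U out G.dst)
    (isUnit_iff_ne_zero.2 (lap_det_ne_zero G out hout hesc U))
  have h3 := congrFun (congrFun h2 ⟨v, hv⟩) ⟨w, hw⟩
  rw [Matrix.mul_apply, Matrix.one_apply] at h3
  simp only [Subtype.mk.injEq] at h3
  rw [← h3]
  apply Finset.sum_congr rfl
  intro y _
  rw [← gr_coe G out y ⟨w, hw⟩]

open Classical in
theorem gr_left (hout : ∀ v e, e ∈ out v ↔ G.src e = v)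
    (hesc : ∀ Q : Set V, Q.Finite → Q.Nonempty → ∃ e, G.src e ∈ Q ∧ G.dst e ∉ Q)
    {U : Finset V} (x : V) (w : U) :
    ∑ y : U, gr G out U x y * rowMat U out G.dst y w = if x = w then 1 else 0 := by
  by_cases hx : x ∈ U
  · have h2 := Matrix.nonsing_inv_mul (rowMat U out G.dst)
      (isUnit_iff_ne_zero.2 (lap_det_ne_zero G out hout hesc U))
    have h3 := congrFun (congrFun h2 ⟨x, hx⟩) w
    rw [Matrix.mul_apply, Matrix.one_apply] at h3
    simp only [Subtype.ext_iff] at h3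
    rw [← h3]
    apply Finset.sum_congr rfl
    intro y _
    rw [← gr_coe G out ⟨x, hx⟩ y]
  · rw [if_neg (fun h : x = (w : V) => hx (by rw [h]; exact w.2))]
    apply Finset.sum_eq_zero
    intro y _
    rw [gr_left_zero G out hx, zero_mul]

theorem gr_nonneg (hout : ∀ v e, e ∈ out v ↔ G.src e = v)
    (hesc : ∀ Q : Set V, Q.Finite → Q.Nonempty → ∃ e, G.src e ∈ Q ∧ G.dst e ∉ Q)
    (U : Finset V) (x w : V) : 0 ≤ gr G out U x w := by
  classical
  by_cases hw : w ∈ U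
  · refine max_principle G out hout hesc U (fun x => gr G out U x w) (fun v hv => ?_)
      (fun v hv => (gr_left_zero G out hv).ge) x
    rw [gr_eq G out hout hesc hv hw]
    split_ifs <;> norm_num
  · rw [gr_right_zero G out hw]

theorem gr_mono (hout : ∀ v e, e ∈ out v ↔ G.src e = v)
    (hesc : ∀ Q : Set V, Q.Finite → Q.Nonempty → ∃ e, G.src e ∈ Q ∧ G.dst e ∉ Q)
    {U U' : Finset V} (hU : U ⊆ U') (x w : V) : gr G out U x w ≤ gr G out U' x w := by
  classical
  by_cases hw : w ∈ U
  · have := max_principle G out hout hesc U (fun x => gr G out U' x w - gr G out U x w)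
      (fun v hv => ?_) (fun v hv => ?_) x
    · linarith
    · have h1 := gr_eq G out hout hesc hv hw
      have h2 := gr_eq G out hout hesc (hU hv) (hU hw)
      have h3 : ∑ e ∈ out v, ((gr G out U' v w - gr G out U v w) -
          (gr G out U' (G.dst e) w - gr G out U (G.dst e) w)) =
          ∑ e ∈ out v, (gr G out U' v w - gr G out U' (G.dst e) w) -
          ∑ e ∈ out v, (gr G out U v w - gr G out U (G.dst e) w) := by
        rw [← Finset.sum_sub_distrib]
        apply Finset.sum_congr rfl
        intro e _
        ring
      rw [h3, h1, h2, sub_self]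
    · simp only [gr_left_zero G out hv, sub_zero]
      exact gr_nonneg G out hout hesc U' v w
  · rw [gr_right_zero G out hw]
    exact gr_nonneg G out hout hesc U' x w

open Classical in
theorem gr_source (inn : V → Finset E) (o : V) (hout : ∀ v e, e ∈ out v ↔ G.src e = v)
    (hin : ∀ v e, e ∈ inn v ↔ G.dst e = v)
    (hbal : ∀ w, (inn w).card + (if w = o then 1 else 0) = (out w).card)
    (hesc : ∀ Q : Set V, Q.Finite → Q.Nonempty → ∃ e, G.src e ∈ Q ∧ G.dst e ∉ Q)
    (U : Finset V) (w : V) : gr G out U o w ≤ 1 := by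
  by_cases h : o ∈ U ∧ w ∈ U
  swap
  · simp [gr, h]
  obtain ⟨ho, hw⟩ := h
  -- column sums of the Laplacian
  have hcol : ∀ y : U, (if (y : V) = o then (1 : ℝ) else 0) ≤ ∑ v : U, rowMat U out G.dst v y := by
    intro y
    have h1 : ∑ v : U, rowMat U out G.dst v y =
        (out y).card - ∑ v : U, (((out v).filter (fun e => G.dst e = y)).card : ℝ) := by
      simp only [rowMat, Matrix.of_apply, Finset.sum_sub_distrib]
      congr 1
      · simp [apply_ite]
      · simp
    have h2 : ∑ v : U, ((out v).filter (fun e => G.dst e = y)).card ≤ (inn y).card := by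
      rw [← Finset.card_biUnion]
      · apply Finset.card_le_card
        intro e he
        simp only [Finset.mem_biUnion, Finset.mem_filter] at he
        obtain ⟨v, _, _, he⟩ := he
        exact (hin _ _).2 he
      · intro a _ b _ hab
        rw [Function.onFun, Finset.disjoint_left]
        intro e he he'
        rw [Finset.mem_filter, hout] at he he'
        exact hab (Subtype.ext (he.1.symm.trans he'.1))
    have h3 := hbal y
    have h2' : ∑ v : U, (((out v).filter (fun e => G.dst e = y)).card : ℝ) ≤ (inn y).card := by
      exact_mod_cast h2
    have h3' : ((inn y).card : ℝ) + (if (y : V) = o then 1 else 0) = (out y).card := by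
      exact_mod_cast h3
    rw [h1]
    linarith
  have hinv : ∀ v : U, ∑ y : U, rowMat U out G.dst v y * gr G out U y w =
      if (v : V) = w then 1 else 0 := by
    intro v
    rw [rowMat_mul_sum U out G.dst (fun x => gr G out U x w)
      (fun x hx => gr_left_zero G out hx) v]
    exact gr_eq G out hout hesc v.2 hw
  have htot : ∑ y : U, (∑ v : U, rowMat U out G.dst v y) * gr G out U y w = 1 := by
    simp only [Finset.sum_mul]
    rw [Finset.sum_comm]
    simp only [hinv]
    rw [Finset.sum_eq_single ⟨w, hw⟩]
    · simp
    · intro y _ hy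
      have : (y : V) ≠ w := fun h => hy (Subtype.ext h)
      simp [this]
    · simp
  rw [← htot]
  calc gr G out U o w = ∑ y : U, (if (y : V) = o then (1 : ℝ) else 0) * gr G out U y w := by
        rw [Finset.sum_eq_single ⟨o, ho⟩]
        · simp
        · intro y _ hy
          have : (y : V) ≠ o := fun h => hy (Subtype.ext h)
          simp [this]
        · simp
    _ ≤ _ := by
        apply Finset.sum_le_sum
        intro y _
        exact mul_le_mul_of_nonneg_right (hcol y) (gr_nonneg G out hout hesc U y w)

theorem gr_bdd (inn : V → Finset E) (o : V) (hout : ∀ v e, e ∈ out v ↔ G.src e = v)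
    (hin : ∀ v e, e ∈ inn v ↔ G.dst e = v)
    (hbal : ∀ w, (inn w).card + (open Classical in if w = o then 1 else 0) = (out w).card)
    (hesc : ∀ Q : Set V, Q.Finite → Q.Nonempty → ∃ e, G.src e ∈ Q ∧ G.dst e ∉ Q)
    (x : V) (hx : Relation.ReflTransGen G.dirAdj o x) :
    ∃ C, ∀ U w, gr G out U x w ≤ C := by
  classical
  induction hx with
  | refl => exact ⟨1, fun U w => gr_source G out inn o hout hin hbal hesc U w⟩
  | @tail b c _ hs ih =>
    obtain ⟨C, hC⟩ := ih
    obtain ⟨e, hb, rfl⟩ := hs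
    refine ⟨(out b).card * C, fun U w => ?_⟩
    refine (gr_mono G out hout hesc (Finset.subset_insert b U) _ w).trans ?_
    set U' := insert b U with hU'
    have hbU : b ∈ U' := Finset.mem_insert_self b U
    by_cases hw : w ∈ U'
    · have h1 := gr_eq G out hout hesc hbU hw
      have h2 : (0 : ℝ) ≤ if b = w then 1 else 0 := by split_ifs <;> norm_num
      rw [← h1, Finset.sum_sub_distrib, Finset.sum_const, nsmul_eq_mul] at h2
      have h3 : gr G out U' (G.dst e) w ≤ ∑ e ∈ out b, gr G out U' (G.dst e) w :=
        Finset.single_le_sum (f := fun e => gr G out U' (G.dst e) w)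
          (fun i _ => gr_nonneg G out hout hesc U' _ w) ((hout _ _).2 hb)
      have h4 : ((out b).card : ℝ) * gr G out U' b w ≤ (out b).card * C :=
        mul_le_mul_of_nonneg_left (hC U' w) (Nat.cast_nonneg _)
      linarith
    · rw [gr_right_zero G out hw]
      have := (gr_nonneg G out hout hesc U' b w).trans (hC U' w)
      positivity

end Green

section Ratio

variable {V E : Type} (G : DigraphStruct V E) (out : V → Finset E)

open Classical in
/-- All orderings of the edges out of `v`. -/
noncomputable def full (v : V) : Finset (List E) := (out v).toList.permutations.toFinset

theorem mem_full {v : V} {l : List E} : l ∈ full out v ↔ l.Perm (out v).toList := by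
  simp [full]

theorem mem_full_iff (hout : ∀ v e, e ∈ out v ↔ G.src e = v) {v : V} {l : List E} :
    l ∈ full out v ↔ IsOrd G v l := by
  rw [mem_full]
  constructor
  · intro h
    refine ⟨h.nodup_iff.2 (Finset.nodup_toList _), fun e => ?_⟩
    rw [h.mem_iff, Finset.mem_toList, hout]
  · rintro ⟨h1, h2⟩
    rw [List.perm_ext_iff_of_nodup h1 (Finset.nodup_toList _)]
    intro e
    rw [h2, Finset.mem_toList, hout]

open Classical in
theorem full_card_le (v : V) {e e' : E} (he : e ∈ out v) (he' : e' ∈ out v) :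
    ((full out v).filter (fun l => l.getLast? = some e)).card ≤
      ((full out v).filter (fun l => l.getLast? = some e')).card := by
  apply Finset.card_le_card_of_injOn (fun l => l.map (Equiv.swap e e'))
  · intro l hl
    simp only [Finset.coe_filter, Set.mem_ofPred_eq] at hl ⊢
    obtain ⟨h1, h2⟩ := hl
    rw [mem_full] at h1
    refine ⟨?_, by rw [List.getLast?_map, h2]; simp⟩
    rw [mem_full]
    have hn : l.Nodup := h1.nodup_iff.2 (Finset.nodup_toList _)
    rw [List.perm_ext_iff_of_nodup (hn.map (Equiv.injective _)) (Finset.nodup_toList _)]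
    intro x
    simp only [List.mem_map, h1.mem_iff, Finset.mem_toList]
    constructor
    · rintro ⟨y, hy, rfl⟩
      by_cases h3 : y = e
      · subst h3; simpa using he'
      · by_cases h4 : y = e'
        · subst h4; simpa using he
        · rwa [Equiv.swap_apply_of_ne_of_ne h3 h4]
    · intro hx
      refine ⟨Equiv.swap e e' x, ?_, by simp⟩
      by_cases h3 : x = e
      · subst h3; simpa using he'
      · by_cases h4 : x = e'
        · subst h4; simpa using he
        · rwa [Equiv.swap_apply_of_ne_of_ne h3 h4]
  · intro l _ l' _ h
    exact List.map_injective_iff.2 (Equiv.injective _) h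

open Classical in
theorem full_sum (hne : ∀ v, (out v).Nonempty) (o : V) :
    ∃ a : V → ℝ, (∀ v, 0 < a v) ∧ ∀ (v : V) (F : V → ℝ),
      ∑ ω ∈ full out v, F (tgt G o ω) = a v * ∑ e ∈ out v, F (G.dst e) := by
  refine ⟨fun v => ((full out v).filter (fun l => l.getLast? = some (hne v).choose)).card,
    fun v => ?_, fun v F => ?_⟩
  · have h := (hne v).choose_spec
    set e := (hne v).choose
    rw [Nat.cast_pos, Finset.card_pos]
    refine ⟨((out v).erase e).toList ++ [e], ?_⟩
    rw [Finset.mem_filter, mem_full]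
    refine ⟨?_, by simp only [List.getLast?_append, List.getLast?_singleton]; rfl⟩
    rw [List.perm_ext_iff_of_nodup _ (Finset.nodup_toList _)]
    · intro x
      simp only [List.mem_append, Finset.mem_toList, Finset.mem_erase, List.mem_singleton]
      constructor
      · rintro (h1 | rfl)
        · exact h1.2
        · exact h
      · intro hx
        by_cases hxe : x = e
        · exact Or.inr hxe
        · exact Or.inl ⟨hxe, hx⟩
    · rw [List.nodup_append]
      refine ⟨Finset.nodup_toList _, by simp, ?_⟩
      intro x hx y hy
      simp only [Finset.mem_toList, Finset.mem_erase, List.mem_singleton] at hx hy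
      rw [hy]
      exact hx.1
  · have h1 : ∀ ω ∈ full out v, F (tgt G o ω) =
        ∑ e ∈ out v, if ω.getLast? = some e then F (G.dst e) else 0 := by
      intro ω hω
      rw [mem_full] at hω
      have hω0 : ω ≠ [] := by
        rintro rfl
        obtain ⟨e, he⟩ := hne v
        have := (hω.mem_iff (a := e)).2 (Finset.mem_toList.2 he)
        simp at this
      obtain ⟨e, he⟩ : ∃ e, ω.getLast? = some e := ⟨_, List.getLast?_eq_getLast_of_ne_nil hω0⟩
      have hem : e ∈ out v := by
        have := List.mem_of_getLast? he
        rwa [hω.mem_iff, Finset.mem_toList] at this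
      rw [tgt_eq G he, Finset.sum_eq_single e]
      · simp [he]
      · intro e' _ hne'
        rw [he, if_neg]
        simpa using Ne.symm hne'
      · exact fun h => absurd hem h
    rw [Finset.sum_congr rfl h1, Finset.sum_comm, Finset.mul_sum]
    apply Finset.sum_congr rfl
    intro e he
    rw [← Finset.sum_filter, Finset.sum_const, nsmul_eq_mul]
    congr 2
    exact le_antisymm (full_card_le out v he (hne v).choose_spec)
      (full_card_le out v (hne v).choose_spec he)

/-- The transfer matrix entries. -/
noncomputable def tm (o : V) (Ω : V → Finset (List E)) (U : Finset V) (v w : V) : ℝ :=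
  ∑ ω ∈ Ω v, (gr G out U v w - gr G out U (tgt G o ω) w)

open Classical in
theorem rowMat_factor (hout : ∀ v e, e ∈ out v ↔ G.src e = v)
    (hesc : ∀ Q : Set V, Q.Finite → Q.Nonempty → ∃ e, G.src e ∈ Q ∧ G.dst e ∉ Q)
    (o : V) (Ω : V → Finset (List E)) (U : Finset V) :
    rowMat U Ω (tgt G o) = (Matrix.of fun v w : U => tm G out o Ω U v w) *
      rowMat U out G.dst := by
  ext v w
  rw [Matrix.mul_apply]
  simp only [Matrix.of_apply, tm, Finset.sum_mul]
  rw [Finset.sum_comm]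
  conv_lhs => rw [rowMat, Matrix.of_apply]
  apply Finset.sum_congr rfl
  intro ω _
  simp only [sub_mul, Finset.sum_sub_distrib]
  rw [gr_left G out hout hesc, gr_left G out hout hesc]
  congr 1
  by_cases h : v = w
  · rw [if_pos h, if_pos (congrArg _ h)]
  · rw [if_neg h, if_neg (fun h' => h (Subtype.ext h'))]

open Classical in
theorem ratio (hout : ∀ v e, e ∈ out v ↔ G.src e = v)
    (hesc : ∀ Q : Set V, Q.Finite → Q.Nonempty → ∃ e, G.src e ∈ Q ∧ G.dst e ∉ Q)
    (o : V) (a : V → ℝ)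
    (ha : ∀ (v : V) (F : V → ℝ),
      ∑ ω ∈ full out v, F (tgt G o ω) = a v * ∑ e ∈ out v, F (G.dst e))
    (K U : Finset V) (hKU : K ⊆ U) (Ω : V → Finset (List E))
    (hΩ : ∀ v, v ∉ K → Ω v = full out v) :
    ((validSet U Ω (tgt G o)).card : ℝ) * ∏ v ∈ K, a v =
      (Matrix.of fun v w : K => tm G out o Ω U v w).det *
        (validSet U (full out) (tgt G o)).card := by
  have hrow : ∀ v ∈ U, ∀ w ∈ U, tm G out o (full out) U v w = if v = w then a v else 0 := by
    intro v hv w hw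
    rw [tm, ha v (fun x => gr G out U v w - gr G out U x w), gr_eq G out hout hesc hv hw]
    simp
  rw [← matrix_tree, ← matrix_tree, rowMat_factor G out hout hesc, rowMat_factor G out hout hesc,
    Matrix.det_mul, Matrix.det_mul]
  have h1 : (Matrix.of fun v w : U => tm G out o (full out) U v w).det = ∏ v ∈ U, a v := by
    have : (Matrix.of fun v w : U => tm G out o (full out) U v w) =
        Matrix.diagonal (fun v : U => a v) := by
      ext v w
      rw [Matrix.of_apply, hrow v v.2 w w.2, Matrix.diagonal_apply]
      by_cases h : v = w
      · rw [if_pos h, if_pos (congrArg _ h)]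
      · rw [if_neg h, if_neg (fun h' => h (Subtype.ext h'))]
    rw [this, Matrix.det_diagonal, Finset.prod_coe_sort U a]
  have h2 : (Matrix.of fun v w : U => tm G out o Ω U v w).det =
      (Matrix.of fun v w : K => tm G out o Ω U v w).det * ∏ v ∈ U \ K, a v := by
    have hr : ∀ v : U, (v : V) ∉ K → ∀ w : U, tm G out o Ω U v w = if v = w then a v else 0 := by
      intro v hv w
      have := hrow v v.2 w w.2
      rw [tm] at this ⊢
      rw [hΩ v hv, this]
      by_cases h : v = w
      · rw [if_pos h, if_pos (congrArg _ h)]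
      · rw [if_neg h, if_neg (fun h' => h (Subtype.ext h'))]
    rw [Matrix.twoBlockTriangular_det _ (fun v : U => (v : V) ∈ K)]
    · congr 1
      · let φ : {v : U // (v : V) ∈ K} ≃ K :=
          { toFun := fun v => ⟨v.1, v.2⟩
            invFun := fun v => ⟨⟨v.1, hKU v.2⟩, v.2⟩
            left_inv := fun v => rfl
            right_inv := fun v => rfl }
        rw [← Matrix.det_submatrix_equiv_self φ]
        rfl
      · have : (Matrix.of fun v w : U => tm G out o Ω U v w).toSquareBlockProp
            (fun v : U => ¬ (v : V) ∈ K) = Matrix.diagonal (fun v => a v.1) := by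
          ext v w
          rw [Matrix.toSquareBlockProp_def, Matrix.of_apply, Matrix.of_apply, hr v.1 v.2 w.1,
            Matrix.diagonal_apply]
          by_cases h : v = w
          · rw [if_pos h, if_pos (congrArg _ h)]
          · rw [if_neg h, if_neg (fun h' => h (Subtype.ext h'))]
        rw [this, Matrix.det_diagonal]
        refine Finset.prod_bij (fun v _ => (v.1 : V)) ?_ ?_ ?_ ?_
        · intro v _
          exact Finset.mem_sdiff.2 ⟨v.1.2, v.2⟩
        · intro v _ w _ h
          exact Subtype.ext (Subtype.ext h)
        · intro v hv
          obtain ⟨h3, h4⟩ := Finset.mem_sdiff.1 hv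
          exact ⟨⟨⟨v, h3⟩, h4⟩, Finset.mem_univ _, rfl⟩
        · intro v _
          rfl
    · intro v hv w hw
      rw [Matrix.of_apply, hr v hv w, if_neg]
      rintro rfl
      exact hv hw
  rw [h1, h2, ← Finset.prod_sdiff hKU]
  ring

open Classical in
theorem full_card_pos (hout : ∀ v e, e ∈ out v ↔ G.src e = v)
    (hesc : ∀ Q : Set V, Q.Finite → Q.Nonempty → ∃ e, G.src e ∈ Q ∧ G.dst e ∉ Q)
    (o : V) (a : V → ℝ) (hapos : ∀ v, 0 < a v)
    (ha : ∀ (v : V) (F : V → ℝ),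
      ∑ ω ∈ full out v, F (tgt G o ω) = a v * ∑ e ∈ out v, F (G.dst e)) (U : Finset V) :
    (0 : ℝ) < (validSet U (full out) (tgt G o)).card := by
  have hrow : ∀ v ∈ U, ∀ w ∈ U, tm G out o (full out) U v w = if v = w then a v else 0 := by
    intro v hv w hw
    rw [tm, ha v (fun x => gr G out U v w - gr G out U x w), gr_eq G out hout hesc hv hw]
    simp
  apply lt_of_le_of_ne (Nat.cast_nonneg _)
  apply Ne.symm
  rw [← matrix_tree, rowMat_factor G out hout hesc, Matrix.det_mul]
  apply mul_ne_zero _ (lap_det_ne_zero G out hout hesc U)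
  have : (Matrix.of fun v w : U => tm G out o (full out) U v w) =
      Matrix.diagonal (fun v : U => a v) := by
    ext v w
    rw [Matrix.of_apply, hrow v v.2 w w.2, Matrix.diagonal_apply]
    by_cases h : v = w
    · rw [if_pos h, if_pos (congrArg _ h)]
    · rw [if_neg h, if_neg (fun h' => h (Subtype.ext h'))]
  rw [this, Matrix.det_diagonal]
  exact Finset.prod_ne_zero_iff.2 (fun v _ => (hapos v).ne')

open Classical in
/-- The ratio of the numbers of admissible choices converges. -/
theorem ratio_tendsto (inn : V → Finset E) (o : V) (hout : ∀ v e, e ∈ out v ↔ G.src e = v)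
    (hin : ∀ v e, e ∈ inn v ↔ G.dst e = v)
    (hbal : ∀ w, (inn w).card + (if w = o then 1 else 0) = (out w).card)
    (hesc : ∀ Q : Set V, Q.Finite → Q.Nonempty → ∃ e, G.src e ∈ Q ∧ G.dst e ∉ Q)
    (hreach : ∀ x, Relation.ReflTransGen G.dirAdj o x)
    (hne : ∀ v, (out v).Nonempty)
    (K : Finset V) (Ω : V → Finset (List E)) (hΩ : ∀ v, v ∉ K → Ω v = full out v) :
    (∀ U, (0 : ℝ) < (validSet U (full out) (tgt G o)).card) ∧
    ∃ c : ℝ, Tendsto (fun U : Finset V => ((validSet U Ω (tgt G o)).card : ℝ) /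
      (validSet U (full out) (tgt G o)).card) atTop (nhds c) := by
  obtain ⟨a, hapos, ha⟩ := full_sum G out hne o
  have hpos := full_card_pos G out hout hesc o a hapos ha
  refine ⟨hpos, ?_⟩
  have hgr : ∀ x w, ∃ l, Tendsto (fun U => gr G out U x w) atTop (nhds l) := by
    intro x w
    obtain ⟨C, hC⟩ := gr_bdd G out inn o hout hin hbal hesc x (hreach x)
    refine ⟨_, tendsto_atTop_ciSup (fun U U' h => gr_mono G out hout hesc h x w)
      ⟨C, ?_⟩⟩
    rintro _ ⟨U, rfl⟩
    exact hC U w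
  choose L hL using hgr
  let D : Matrix K K ℝ := Matrix.of fun v w : K => ∑ ω ∈ Ω v, (L v w - L (tgt G o ω) w)
  refine ⟨D.det / ∏ v ∈ K, a v, ?_⟩
  have hdet : Tendsto (fun U : Finset V =>
      (Matrix.of fun v w : K => tm G out o Ω U v w).det) atTop (nhds D.det) := by
    have hc : Continuous (fun M : Matrix K K ℝ => M.det) := Continuous.matrix_det continuous_id
    refine (hc.tendsto D).comp ?_
    refine tendsto_pi_nhds.2 (fun v => tendsto_pi_nhds.2 (fun w => ?_))
    exact tendsto_finsetSum _ (fun ω _ => (hL _ _).sub (hL _ _))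
  refine (hdet.div_const _).congr' ?_
  filter_upwards [eventually_ge_atTop K] with U hU
  have := ratio G out hout hesc o a ha K U hU Ω hΩ
  rw [div_eq_div_iff (Finset.prod_pos (fun v _ => hapos v)).ne' (hpos U).ne']
  exact this.symm

end Ratio

section Paths

variable {V E : Type} (G : DigraphStruct V E)

/-- The first `n` edges of a path. -/
def pre (n : ℕ) (γ : ℕ → E) : List E := (List.range n).map γ

theorem pre_succ (n : ℕ) (γ : ℕ → E) : pre (n + 1) γ = pre n γ ++ [γ n] := by
  simp [pre, List.range_succ]

theorem mem_pre {n : ℕ} {γ : ℕ → E} {e : E} : e ∈ pre n γ ↔ ∃ i < n, γ i = e := by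
  simp [pre]

theorem pre_length (n : ℕ) (γ : ℕ → E) : (pre n γ).length = n := by simp [pre]

/-- Eulerian paths from `o` to infinity. -/
def GoodPath (o : V) (γ : ℕ → E) : Prop :=
  (∀ i : ℕ, G.dst (γ i) = G.src (γ (i + 1))) ∧ G.src (γ 0) = o ∧ Function.Bijective γ

theorem path_append : ∀ (w : List E) (o z : V) (e : E), IsPathList G o z w → G.src e = z →
    IsPathList G o (G.dst e) (w ++ [e]) := by
  intro w
  induction w with
  | nil => intro o z e h he; exact ⟨he.trans (Eq.symm h), rfl⟩
  | cons f w ih => intro o z e h he; exact ⟨h.1, ih _ _ _ h.2 he⟩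

theorem pre_path {o : V} {γ : ℕ → E} (h : GoodPath G o γ) (n : ℕ) :
    IsPathList G o (G.src (γ n)) (pre n γ) := by
  induction n with
  | zero => exact h.2.1.symm
  | succ n ih => rw [pre_succ, ← h.1 n]; exact path_append G _ _ _ _ ih rfl

theorem pre_good {o : V} {γ : ℕ → E} (h : GoodPath G o γ) (n : ℕ) :
    GoodWord G o (pre n γ) := by
  refine ⟨_, pre_path G h n, List.nodup_range.map h.2.2.1, γ n, rfl, fun hm => ?_⟩
  obtain ⟨i, hi, he⟩ := mem_pre.1 hm
  exact hi.ne (h.2.2.1 he)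

theorem pre_le_pre {m n : ℕ} (h : m ≤ n) (γ : ℕ → E) : pre m γ <+: pre n γ := by
  induction n, h using Nat.le_induction with
  | base => exact List.prefix_refl _
  | succ n _ ih => rw [pre_succ]; exact ih.trans (List.prefix_append _ _)

theorem prefix_pre_iff {w : List E} {n : ℕ} (h : w.length ≤ n) (γ : ℕ → E) :
    w <+: pre n γ ↔ pre w.length γ = w := by
  have h1 := pre_le_pre h γ
  constructor
  · intro h2
    have := List.prefix_of_prefix_length_le h1 h2 (by rw [pre_length])
    exact this.eq_of_length (pre_length _ _)
  · intro h2
    rwa [h2] at h1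

theorem exists_src [hV : Infinite V] (hc : G.Connected) {o : V} {γ : ℕ → E} (h : GoodPath G o γ)
    (v : V) : ∃ i, G.src (γ i) = v := by
  obtain ⟨u, hu⟩ := exists_ne v
  rcases Relation.ReflTransGen.cases_head (hc v u) with h1 | ⟨x, ⟨e, he⟩, _⟩
  · exact absurd h1.symm hu
  · obtain ⟨i, rfl⟩ := h.2.2.2 e
    rcases he with he | he
    · exact ⟨i, he.1⟩
    · exact ⟨i + 1, by rw [← h.1 i]; exact he.2⟩

theorem reach_all [Infinite V] (hc : G.Connected) {o : V} {γ : ℕ → E} (h : GoodPath G o γ)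
    (v : V) : Relation.ReflTransGen G.dirAdj o v := by
  obtain ⟨i, rfl⟩ := exists_src G hc h v
  induction i with
  | zero => rw [h.2.1]
  | succ i ih => exact ih.tail ⟨γ i, rfl, h.1 i⟩

theorem finite_times (hl : G.LocallyFinite) {o : V} {γ : ℕ → E} (h : GoodPath G o γ)
    {Q : Set V} (hQ : Q.Finite) : {i | G.src (γ i) ∈ Q}.Finite := by
  have h1 : {e | G.src e ∈ Q}.Finite := by
    have : {e | G.src e ∈ Q} = ⋃ v ∈ Q, G.outEdges v := by
      ext e
      simp [DigraphStruct.outEdges]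
    rw [this]
    exact hQ.biUnion (fun v _ => (hl v).1)
  have h2 : (γ ⁻¹' {e | G.src e ∈ Q}).Finite := h1.preimage h.2.2.1.injOn
  exact h2

theorem escape [Infinite V] (hc : G.Connected) (hl : G.LocallyFinite) {o : V} {γ : ℕ → E}
    (h : GoodPath G o γ) (Q : Set V) (hQ : Q.Finite) (hne : Q.Nonempty) :
    ∃ e, G.src e ∈ Q ∧ G.dst e ∉ Q := by
  by_contra hcon
  push Not at hcon
  obtain ⟨q, hq⟩ := hne
  obtain ⟨i, rfl⟩ := exists_src G hc h q
  have h1 : ∀ j, G.src (γ (i + j)) ∈ Q := by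
    intro j
    induction j with
    | zero => exact hq
    | succ j ih =>
      have := hcon _ ih
      rwa [h.1] at this
  obtain ⟨B, hB⟩ := (finite_times G hl h hQ).bddAbove
  have := hB (h1 (B + 1))
  omega

theorem last_exit {γ : ℕ → E} {u : V} {e : E} : ∀ {n : ℕ},
    (stk G u (pre n γ)).getLast? = some e →
    ∃ i < n, γ i = e ∧ G.src e = u ∧ ∀ j < n, G.src (γ j) = u → j ≤ i := by
  intro n
  induction n with
  | zero => intro h; simp [pre, stk_nil] at h
  | succ n ih =>
    intro h
    rw [pre_succ, stk_append] at h
    by_cases hu : G.src (γ n) = u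
    · rw [stk_cons_eq G hu, stk_nil, List.getLast?_append] at h
      have h : γ n = e := by simpa using h
      exact ⟨n, Nat.lt_succ_self n, h, h ▸ hu, fun j hj _ => Nat.lt_succ_iff.1 hj⟩
    · rw [stk_cons_ne G hu, stk_nil, List.append_nil] at h
      obtain ⟨i, hi, h1, h2, h3⟩ := ih h
      refine ⟨i, hi.trans (Nat.lt_succ_self n), h1, h2, fun j hj hju => ?_⟩
      rcases Nat.lt_succ_iff_lt_or_eq.1 hj with hj | rfl
      · exact h3 j hj hju
      · exact absurd hju hu

theorem eventually_sat (hl : G.LocallyFinite) {o : V} {γ : ℕ → E} (h : GoodPath G o γ) (v : V) :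
    ∀ᶠ n in atTop, v ∈ satSet G (pre n γ) := by
  obtain ⟨t, ht⟩ := (finite_times G hl h (Set.finite_singleton v)).bddAbove
  have hfin : ((fun j => G.src (γ j)) '' Set.Iic t).Finite := (Set.finite_Iic t).image _
  obtain ⟨N, hN⟩ := (finite_times G hl h hfin).bddAbove
  filter_upwards [eventually_gt_atTop N, eventually_gt_atTop t] with n hn hnt
  have key : ∀ u, Relation.ReflTransGen (tstep G (pre n γ)) u v →
      ∀ i, G.src (γ i) = u → i ≤ t := by
    intro u hu
    induction hu using Relation.ReflTransGen.head_induction_on with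
    | refl => intro i hi; exact ht hi
    | head h1 _ ih =>
      rename_i a c _
      obtain ⟨e, he, hec⟩ := h1
      obtain ⟨i, hi, h1, h2, h3⟩ := last_exit G he
      have h4 : G.src (γ (i + 1)) = c := by rw [← h.1 i, h1, hec]
      have h5 := ih _ h4
      intro j hj
      have h6 : j ≤ N := by
        apply hN
        refine ⟨i, ?_, ?_⟩
        · show i ≤ t
          omega
        · show G.src (γ i) = G.src (γ j)
          rw [h1, h2, hj]
      have := h3 j (by omega) hj
      omega
  intro u hu e he
  obtain ⟨i, rfl⟩ := h.2.2.2 e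
  have := key u hu i he
  exact mem_pre.2 ⟨i, by omega, rfl⟩

theorem satSet_finite (hout : ∀ v, ∃ e, G.src e = v) (w : List E) : (satSet G w).Finite := by
  refine ((List.finite_toSet w).image G.src).subset ?_
  intro v hv
  obtain ⟨e, he⟩ := hout v
  exact ⟨e, hv v .refl e he, he⟩

theorem pathlist_get : ∀ (w : List E) (o z : V), IsPathList G o z w →
    (∀ h : 0 < w.length, G.src (w[0]) = o) ∧
      ∀ (i : ℕ) (h : i + 1 < w.length), G.dst (w[i]) = G.src (w[i + 1]) := by
  intro w
  induction w with
  | nil => intro o z _; exact ⟨fun h => absurd h (by simp), fun i h => absurd h (by simp)⟩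
  | cons e w ih =>
    intro o z h
    obtain ⟨h1, h2⟩ := ih _ _ h.2
    refine ⟨fun _ => h.1, fun i hi => ?_⟩
    cases i with
    | zero =>
      have hi : 0 < w.length := by simpa using hi
      exact (h1 hi).symm
    | succ i => exact h2 i (by simpa using hi)

end Paths

section Meas

variable {V E : Type} [Countable V] [Countable E] [MeasurableSpace E] [DiscreteMeasurableSpace E]
  (G : DigraphStruct V E)

theorem measurable_pre (n : ℕ) (P : List E → Prop) :
    MeasurableSet {γ : ℕ → E | P (pre n γ)} := by
  have h1 : Measurable (fun (γ : ℕ → E) (i : Fin n) => γ i) :=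
    measurable_pi_lambda _ (fun i => measurable_pi_apply _)
  have h2 : {γ : ℕ → E | P (pre n γ)} =
      (fun (γ : ℕ → E) (i : Fin n) => γ i) ⁻¹' {f | P (List.ofFn f)} := by
    ext γ
    have : pre n γ = List.ofFn (fun i : Fin n => γ i) := by
      apply List.ext_getElem
      · simp [pre]
      · intro i _ _
        simp [pre]
    simp only [Set.mem_ofPred_eq, Set.mem_preimage, this]
  rw [h2]
  exact h1 (Set.to_countable _).measurableSet

theorem measure_words (μ : Measure (ℕ → E)) (n : ℕ) (P : List E → Prop) :
    μ {γ | P (pre n γ)} = ∑' w : {w // P w}, μ {γ | pre n γ = w} := by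
  rw [← measure_iUnion]
  · congr 1
    ext γ
    simp
  · intro w w' hne
    rw [Function.onFun, Set.disjoint_left]
    intro γ h h'
    exact hne (Subtype.ext (Eq.trans (Eq.symm h) h'))
  · intro w
    exact measurable_pre n (fun l => l = w.1)

theorem gibbs_perm {o : V} {μ : Measure (ℕ → E)} (hμ : ProperGibbs G o μ) (n : ℕ)
    {w w' : List E} (hw : GoodWord G o w) (hw' : GoodWord G o w') (hp : w.Perm w') :
    μ {γ | pre n γ = w} = μ {γ | pre n γ = w'} := by
  have hlen := hp.length_eq
  by_cases hn : w.length = n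
  · subst hn
    obtain ⟨z, hz, hnd, -⟩ := hw
    obtain ⟨z', hz', hnd', -⟩ := hw'
    have key := hμ.2.2 w.length (fun i => w[i.1]) (fun i => w'[i.1]'(by omega))
      (fun i j hij => Fin.ext ((hnd.getElem_inj_iff).1 hij))
      (fun i j hij => Fin.ext ((hnd'.getElem_inj_iff).1 hij))
      (by
        ext e
        simp only [Set.mem_range]
        have h1 : (∃ y : Fin w.length, w[y.1] = e) ↔ e ∈ w := by
          rw [List.mem_iff_getElem]
          exact ⟨fun ⟨y, hy⟩ => ⟨y.1, y.2, hy⟩, fun ⟨i, hi, hy⟩ => ⟨⟨i, hi⟩, hy⟩⟩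
        have h2 : (∃ y : Fin w.length, w'[y.1]'(by omega) = e) ↔ e ∈ w' := by
          rw [List.mem_iff_getElem]
          exact ⟨fun ⟨y, hy⟩ => ⟨y.1, by omega, hy⟩, fun ⟨i, hi, hy⟩ => ⟨⟨i, by omega⟩, hy⟩⟩
        rw [h1, h2, hp.mem_iff])
      ⟨fun h => (pathlist_get G w o z hz).1 h, fun i h => (pathlist_get G w o z hz).2 i h⟩
      ⟨fun h => (pathlist_get G w' o z' hz').1 (by omega),
        fun i h => (pathlist_get G w' o z' hz').2 i (by omega)⟩ Set.univ
    have h1 : ∀ (l : List E) (hl : w.length = l.length), {γ : ℕ → E | pre w.length γ = l} =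
        {γ | (∀ i : Fin w.length, γ (i : ℕ) = l[i.1]'(by omega)) ∧
          (fun t : ℕ => γ (w.length + t)) ∈ Set.univ} := by
      intro l hl
      ext γ
      simp only [Set.mem_ofPred_eq, Set.mem_univ, and_true]
      constructor
      · rintro h i
        have : (pre w.length γ)[i.1]'(by rw [pre_length]; exact i.2) = l[i.1]'(by omega) := by
          simp only [h]
        rw [← this]
        simp [pre]
      · intro h
        apply List.ext_getElem
        · rw [pre_length, hl]
        · intro i h1 h2
          rw [← h ⟨i, by rw [pre_length] at h1; exact h1⟩]
          simp [pre]
    rw [h1 w rfl, h1 w' hlen]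
    exact key
  · have h0 : ∀ l : List E, l.length ≠ n → {γ : ℕ → E | pre n γ = l} = ∅ := by
      intro l hl
      ext γ
      simp only [Set.mem_ofPred_eq, Set.mem_empty_iff_false, iff_false]
      rintro rfl
      exact hl (pre_length _ _)
    rw [h0 w hn, h0 w' (by omega)]

/-- Words with saturated set `U` and stacks `s`. -/
def MW (o : V) (U : Finset V) (s : U → List E) (w : List E) : Prop :=
  GoodWord G o w ∧ satSet G w = U ∧ (fun v : U => stk G v w) = s

theorem mass_le {o : V} {μ : Measure (ℕ → E)} (hμ : ProperGibbs G o μ) (n : ℕ) (U : Finset V)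
    (s s' : U → List E) (hs' : ∀ v : U, IsOrd G v (s' v))
    (hex : Exits U (fun v => tgt G o (s' v))) :
    μ {γ | MW G o U s (pre n γ)} ≤ μ {γ | MW G o U s' (pre n γ)} := by
  rw [measure_words μ n (MW G o U s), measure_words μ n (MW G o U s')]
  have ht : ∀ w : {w // MW G o U s w}, ∃ w', GoodWord G o w' ∧ w'.Perm w ∧ satSet G w' = U ∧
      (∀ v : U, stk G v w' = s' v) ∧ ∀ v, v ∉ U → stk G v w' = stk G v w :=
    fun w => transport G w.2.1 w.2.2.1 s' hs' hex
  choose φ h1 h2 h3 h4 h5 using ht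
  let ψ : {w // MW G o U s w} → {w // MW G o U s' w} :=
    fun w => ⟨φ w, h1 w, h3 w, funext (h4 w)⟩
  have hinj : Function.Injective ψ := by
    intro w w' h
    have h : φ w = φ w' := congrArg Subtype.val h
    obtain ⟨z, hz, -⟩ := w.2.1
    obtain ⟨z', hz', -⟩ := w'.2.1
    apply Subtype.ext
    apply eq_of_stk G hz hz'
    intro v
    by_cases hv : v ∈ U
    · have e1 := congrFun w.2.2.2 ⟨v, hv⟩
      have e2 := congrFun w'.2.2.2 ⟨v, hv⟩
      exact e1.trans e2.symm
    · rw [← h5 w v hv, ← h5 w' v hv, h]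
  calc ∑' w : {w // MW G o U s w}, μ {γ | pre n γ = w}
      = ∑' w : {w // MW G o U s w}, μ {γ | pre n γ = (ψ w).1} := by
        apply tsum_congr
        intro w
        exact gibbs_perm G hμ n w.2.1 (h1 w) (h2 w).symm
    _ ≤ _ := ENNReal.tsum_comp_le_tsum_of_injective hinj
        (fun w : {w // MW G o U s' w} => μ {γ | pre n γ = w})

theorem sum_fibre (μ : Measure (ℕ → E)) {o : V} (n : ℕ) (U : Finset V) (F : Finset (U → List E)) :
    μ {γ | GoodWord G o (pre n γ) ∧ satSet G (pre n γ) = U ∧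
      (fun v : U => stk G v (pre n γ)) ∈ F} = ∑ s ∈ F, μ {γ | MW G o U s (pre n γ)} := by
  rw [← measure_biUnion_finset]
  · congr 1
    ext γ
    simp only [Set.mem_ofPred_eq, Set.mem_iUnion, MW, exists_prop]
    constructor
    · rintro ⟨h1, h2, h3⟩
      exact ⟨_, h3, h1, h2, rfl⟩
    · rintro ⟨s, hs, h1, h2, rfl⟩
      exact ⟨h1, h2, hs⟩
  · intro s _ s' _ hne
    rw [Function.onFun, Set.disjoint_left]
    intro γ h h'
    exact hne (h.2.2.symm.trans h'.2.2)
  · intro s _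
    exact measurable_pre n (MW G o U s)

theorem core_ratio (out : V → Finset E) (hout : ∀ v e, e ∈ out v ↔ G.src e = v)
    (hne : ∀ v, (out v).Nonempty) {o : V} {μ : Measure (ℕ → E)} (hμ : ProperGibbs G o μ) (n : ℕ)
    (U : Finset V) (F : Finset (U → List E)) (hF : F ⊆ validSet U (full out) (tgt G o)) :
    μ {γ | GoodWord G o (pre n γ) ∧ satSet G (pre n γ) = U ∧
      (fun v : U => stk G v (pre n γ)) ∈ F} * (validSet U (full out) (tgt G o)).card =
    F.card * μ {γ | GoodWord G o (pre n γ) ∧ satSet G (pre n γ) = U} := by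
  classical
  have hval : ∀ s, s ∈ validSet U (full out) (tgt G o) ↔
      (∀ v : U, IsOrd G v (s v)) ∧ Exits U (fun v => tgt G o (s v)) := by
    intro s
    simp only [validSet, Finset.mem_filter, Fintype.mem_piFinset, mem_full_iff G out hout]
  have hfull : {γ | GoodWord G o (pre n γ) ∧ satSet G (pre n γ) = U} =
      {γ | GoodWord G o (pre n γ) ∧ satSet G (pre n γ) = U ∧
      (fun v : U => stk G v (pre n γ)) ∈ validSet U (full out) (tgt G o)} := by
    ext γ
    simp only [Set.mem_ofPred_eq]
    constructor
    · rintro ⟨h1, h2⟩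
      refine ⟨h1, h2, (hval _).2 ⟨fun v => ?_, ?_⟩⟩
      · obtain ⟨z, -, hnd, -⟩ := h1
        apply satSet_isOrd G hnd
        rw [h2]
        exact v.2
      · exact satSet_exits G (fun v => by
          obtain ⟨e, he⟩ := hne v
          exact ⟨e, (hout v e).1 he⟩) h1 h2
    · rintro ⟨h1, h2, -⟩
      exact ⟨h1, h2⟩
  rw [hfull, sum_fibre, sum_fibre]
  rcases F.eq_empty_or_nonempty with rfl | ⟨s0, hs0⟩
  · simp
  have hconst : ∀ s ∈ validSet U (full out) (tgt G o),
      μ {γ | MW G o U s (pre n γ)} = μ {γ | MW G o U s0 (pre n γ)} := by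
    intro s hs
    have h1 := (hval s).1 hs
    have h2 := (hval s0).1 (hF hs0)
    exact le_antisymm (mass_le G hμ n U s s0 h2.1 h2.2) (mass_le G hμ n U s0 s h1.1 h1.2)
  rw [Finset.sum_congr rfl hconst, Finset.sum_congr rfl (fun s hs => hconst s (hF hs)),
    Finset.sum_const, Finset.sum_const, nsmul_eq_mul, nsmul_eq_mul]
  ring

end Meas

section Final

variable {V E : Type} [Countable V] [Countable E] [MeasurableSpace E] [DiscreteMeasurableSpace E]
  (G : DigraphStruct V E)

theorem mem_validSet {o : V} {U : Finset V} {Ω : V → Finset (List E)} {s : U → List E} :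
    s ∈ validSet U Ω (tgt G o) ↔ (∀ v : U, s v ∈ Ω v) ∧ Exits U (fun v => tgt G o (s v)) := by
  classical
  simp only [validSet, Finset.mem_filter, Fintype.mem_piFinset]

theorem good_valid (out : V → Finset E) (hout : ∀ v e, e ∈ out v ↔ G.src e = v)
    (hne : ∀ v, (out v).Nonempty) {o : V} {w : List E} (h1 : GoodWord G o w) {U : Finset V}
    (h2 : satSet G w = U) : (fun v : U => stk G v w) ∈ validSet U (full out) (tgt G o) := by
  refine (mem_validSet G).2 ⟨fun v => ?_, ?_⟩
  · obtain ⟨z, -, hnd, -⟩ := h1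
    rw [mem_full_iff G out hout]
    apply satSet_isOrd G hnd
    rw [h2]
    exact v.2
  · exact satSet_exits G (fun v => by
      obtain ⟨e, he⟩ := hne v
      exact ⟨e, (hout v e).1 he⟩) h1 h2

theorem measurable_two (i j : ℕ) (Q : E → E → Prop) :
    MeasurableSet {γ : ℕ → E | Q (γ i) (γ j)} := by
  have h1 : Measurable (fun γ : ℕ → E => (γ i, γ j)) :=
    (measurable_pi_apply i).prodMk (measurable_pi_apply j)
  exact h1 (Set.to_countable {p : E × E | Q p.1 p.2}).measurableSet

theorem measurable_good (o : V) : MeasurableSet {γ : ℕ → E | GoodPath G o γ} := by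
  have h : {γ : ℕ → E | GoodPath G o γ} =
      (⋂ i : ℕ, {γ : ℕ → E | G.dst (γ i) = G.src (γ (i + 1))}) ∩ ({γ | G.src (γ 0) = o} ∩
        ((⋂ i : ℕ, ⋂ j : ℕ, {γ : ℕ → E | γ i = γ j → i = j}) ∩
          ⋂ e : E, ⋃ i : ℕ, {γ : ℕ → E | γ i = e})) := by
    ext γ
    simp only [GoodPath, Function.Bijective, Function.Injective, Function.Surjective,
      Set.mem_ofPred_eq, Set.mem_inter_iff, Set.mem_iInter, Set.mem_iUnion]
  rw [h]
  refine (MeasurableSet.iInter fun i => ?_).inter (MeasurableSet.inter ?_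
    (MeasurableSet.inter (MeasurableSet.iInter fun i => MeasurableSet.iInter fun j => ?_)
      (MeasurableSet.iInter fun e => MeasurableSet.iUnion fun i => ?_)))
  · exact measurable_two i (i + 1) (fun a b => G.dst a = G.src b)
  · exact measurable_two 0 0 (fun a _ => G.src a = o)
  · exact measurable_two i j (fun a b => a = b → i = j)
  · exact measurable_two i i (fun a _ => a = e)

theorem ae_good {o : V} {μ : Measure (ℕ → E)} (hμ : ProperGibbs G o μ) :
    ∀ᵐ γ ∂μ, GoodPath G o γ := by
  haveI : IsProbabilityMeasure μ := ⟨hμ.1⟩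
  exact (mem_ae_iff_prob_eq_one (measurable_good G o)).2 hμ.2.1

theorem sat_mass_tendsto (hl : G.LocallyFinite) {o : V} {μ : Measure (ℕ → E)}
    (hμ : ProperGibbs G o μ) (W : Finset V) :
    Tendsto (fun n => μ {γ | GoodWord G o (pre n γ) ∧ (W : Set V) ⊆ satSet G (pre n γ)})
      atTop (nhds 1) := by
  haveI : IsProbabilityMeasure μ := ⟨hμ.1⟩
  rw [← hμ.1]
  apply tendsto_measure_of_ae_tendsto_indicator_of_isFiniteMeasure atTop MeasurableSet.univ
  · intro n
    exact measurable_pre n (fun w => GoodWord G o w ∧ (W : Set V) ⊆ satSet G w)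
  · filter_upwards [ae_good G hμ] with γ hγ
    have h1 : ∀ᶠ n in atTop, ∀ v ∈ W, v ∈ satSet G (pre n γ) :=
      (Filter.eventually_all_finset W).2 (fun v _ => eventually_sat G hl hγ v)
    filter_upwards [h1] with n hn
    simp only [Set.mem_univ, iff_true]
    exact ⟨pre_good G hγ n, fun v hv => hn v hv⟩

theorem sum_over_sat (hout : ∀ v, ∃ e, G.src e = v) (μ : Measure (ℕ → E)) (o : V) (W : Finset V)
    (n : ℕ) (P : List E → Prop) :
    μ {γ | GoodWord G o (pre n γ) ∧ (W : Set V) ⊆ satSet G (pre n γ) ∧ P (pre n γ)} =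
      ∑' U : {U : Finset V // W ⊆ U},
        μ {γ | GoodWord G o (pre n γ) ∧ satSet G (pre n γ) = (U : Finset V) ∧ P (pre n γ)} := by
  rw [← measure_iUnion]
  · congr 1
    ext γ
    simp only [Set.mem_ofPred_eq, Set.mem_iUnion]
    constructor
    · rintro ⟨h1, h2, h3⟩
      have hf := satSet_finite G hout (pre n γ)
      refine ⟨⟨hf.toFinset, fun v hv => ?_⟩, h1, ?_, h3⟩
      · rw [Set.Finite.mem_toFinset]
        exact h2 hv
      · rw [Set.Finite.coe_toFinset]
    · rintro ⟨U, h1, h2, h3⟩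
      refine ⟨h1, ?_, h3⟩
      rw [h2]
      exact_mod_cast U.2
  · intro U U' hne
    rw [Function.onFun, Set.disjoint_left]
    intro γ h h'
    apply hne
    apply Subtype.ext
    have := h.2.1.symm.trans h'.2.1
    exact_mod_cast this
  · intro U
    exact measurable_pre n (fun w => GoodWord G o w ∧ satSet G w = (U : Finset V) ∧ P w)

theorem cyl_value (o : V) (hG : G.IsSourcedEulerian o) {γ₀ : ℕ → E} (hγ₀ : GoodPath G o γ₀)
    (w₀ : List E) (z₀ : V) (hw₀ : IsPathList G o z₀ w₀) :
    ∃ c : ℝ, ∀ μ : Measure (ℕ → E), ProperGibbs G o μ →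
      μ {γ | pre w₀.length γ = w₀} = ENNReal.ofReal c := by
  classical
  haveI := hG.infinite
  have hl := hG.locFin
  have hsrc : ∀ v, ∃ e, G.src e = v := fun v => by
    obtain ⟨i, hi⟩ := exists_src G hG.conn hγ₀ v
    exact ⟨_, hi⟩
  let out : V → Finset E := fun v => (hl v).1.toFinset
  let inn : V → Finset E := fun v => (hl v).2.toFinset
  have hout : ∀ v e, e ∈ out v ↔ G.src e = v := fun v e => by
    simp [out, DigraphStruct.outEdges]
  have hin : ∀ v e, e ∈ inn v ↔ G.dst e = v := fun v e => by
    simp [inn, DigraphStruct.inEdges]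
  have hne : ∀ v, (out v).Nonempty := fun v => by
    obtain ⟨e, he⟩ := hsrc v
    exact ⟨e, (hout v e).2 he⟩
  have hbal : ∀ w, (inn w).card + (if w = o then 1 else 0) = (out w).card := by
    intro w
    have h1 : G.outDeg w = (out w).card := Set.ncard_eq_toFinset_card _ (hl w).1
    have h2 : G.inDeg w = (inn w).card := Set.ncard_eq_toFinset_card _ (hl w).2
    rw [← h1, ← h2]
    by_cases hw : w = o
    · subst hw
      rw [if_pos rfl, hG.source]
    · rw [if_neg hw, hG.balanced w hw, add_zero]
  have hesc := escape G hG.conn hl hγ₀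
  have hreach := reach_all G hG.conn hγ₀
  let K : Finset V := w₀.toFinset.image G.src
  let Ω : V → Finset (List E) := fun v => (full out v).filter (fun l => stk G v w₀ <+: l)
  have hKnil : ∀ v, v ∉ K → stk G v w₀ = [] := by
    intro v hv
    rw [List.eq_nil_iff_forall_not_mem]
    intro e he
    rw [mem_stk] at he
    exact hv (Finset.mem_image.2 ⟨e, List.mem_toFinset.2 he.1, he.2⟩)
  have hΩ : ∀ v, v ∉ K → Ω v = full out v := by
    intro v hv
    apply Finset.filter_true_of_mem
    intro l _
    rw [hKnil v hv]
    exact ⟨_, rfl⟩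
  obtain ⟨hpos, c, hc⟩ := ratio_tendsto G out inn o hout hin hbal hesc hreach hne K Ω hΩ
  refine ⟨c, fun μ hμ => ?_⟩
  haveI : IsProbabilityMeasure μ := ⟨hμ.1⟩
  have hBU : ∀ n (U : Finset V), K ⊆ U →
      μ {γ | GoodWord G o (pre n γ) ∧ satSet G (pre n γ) = U ∧ w₀ <+: pre n γ} =
      ENNReal.ofReal (((validSet U Ω (tgt G o)).card : ℝ) /
        (validSet U (full out) (tgt G o)).card) *
      μ {γ | GoodWord G o (pre n γ) ∧ satSet G (pre n γ) = U} := by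
    intro n U hKU
    have hsub : validSet U Ω (tgt G o) ⊆ validSet U (full out) (tgt G o) := by
      intro s hs
      rw [mem_validSet] at hs ⊢
      exact ⟨fun v => (Finset.mem_filter.1 (hs.1 v)).1, hs.2⟩
    have hset : {γ | GoodWord G o (pre n γ) ∧ satSet G (pre n γ) = U ∧ w₀ <+: pre n γ} =
        {γ | GoodWord G o (pre n γ) ∧ satSet G (pre n γ) = U ∧
          (fun v : U => stk G v (pre n γ)) ∈ validSet U Ω (tgt G o)} := by
      ext γ
      simp only [Set.mem_ofPred_eq]
      refine and_congr_right (fun h1 => and_congr_right (fun h2 => ?_))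
      have h3 := good_valid G out hout hne h1 h2
      rw [mem_validSet] at h3 ⊢
      constructor
      · intro h4
        exact ⟨fun v => Finset.mem_filter.2 ⟨h3.1 v, stk_pref_mono G v h4⟩, h3.2⟩
      · rintro ⟨h4, -⟩
        obtain ⟨z, hz, -⟩ := h1
        apply prefix_of_stk G _ _ _ _ _ hw₀ hz
        intro v
        by_cases hv : v ∈ U
        · exact (Finset.mem_filter.1 (h4 ⟨v, hv⟩)).2
        · rw [hKnil v (fun h => hv (hKU h))]
          exact ⟨_, rfl⟩
    have hcore := core_ratio G out hout hne hμ n U _ hsub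
    rw [hset, ENNReal.ofReal_div_of_pos (hpos U), ENNReal.ofReal_natCast, ENNReal.ofReal_natCast]
    have h0 : ((validSet U (full out) (tgt G o)).card : ℝ≥0∞) ≠ 0 := by
      have := hpos U
      rw [Nat.cast_pos] at this
      exact_mod_cast this.ne'
    rw [← ENNReal.mul_div_right_comm, ENNReal.eq_div_iff h0 (ENNReal.natCast_ne_top _), mul_comm]
    exact hcore
  have hmeasA : ∀ (W : Finset V) n, MeasurableSet
      {γ | GoodWord G o (pre n γ) ∧ (W : Set V) ⊆ satSet G (pre n γ)} := fun W n =>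
    measurable_pre n (fun w => GoodWord G o w ∧ (W : Set V) ⊆ satSet G w)
  have hbound : ∀ ε : ℝ, 0 < ε → ENNReal.ofReal (c - ε) ≤ μ {γ | pre w₀.length γ = w₀} ∧
      μ {γ | pre w₀.length γ = w₀} ≤ ENNReal.ofReal (c + ε) := by
    intro ε hε
    have hev : ∀ᶠ U : Finset V in atTop, ((validSet U Ω (tgt G o)).card : ℝ) /
        (validSet U (full out) (tgt G o)).card ∈ Set.Icc (c - ε) (c + ε) :=
      hc (Icc_mem_nhds (by linarith) (by linarith))
    obtain ⟨W', hW'⟩ := eventually_atTop.1 hev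
    let W := W' ∪ K
    have hW : ∀ U, W ⊆ U → ((validSet U Ω (tgt G o)).card : ℝ) /
        (validSet U (full out) (tgt G o)).card ∈ Set.Icc (c - ε) (c + ε) :=
      fun U hU => hW' U (Finset.subset_union_left.trans hU)
    have hWK : ∀ U, W ⊆ U → K ⊆ U := fun U hU => Finset.subset_union_right.trans hU
    have hA : ∀ n, μ {γ | GoodWord G o (pre n γ) ∧ (W : Set V) ⊆ satSet G (pre n γ)} =
        ∑' U : {U : Finset V // W ⊆ U},
          μ {γ | GoodWord G o (pre n γ) ∧ satSet G (pre n γ) = (U : Finset V)} := by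
      intro n
      have := sum_over_sat G hsrc μ o W n (fun _ => True)
      simpa only [and_true] using this
    have hB := fun n => sum_over_sat G hsrc μ o W n (fun w => w₀ <+: w)
    have hlim := sat_mass_tendsto G hl hμ W
    have hlow : ∀ n, ENNReal.ofReal (c - ε) *
        μ {γ | GoodWord G o (pre n γ) ∧ (W : Set V) ⊆ satSet G (pre n γ)} ≤
        μ {γ | GoodWord G o (pre n γ) ∧ (W : Set V) ⊆ satSet G (pre n γ) ∧ w₀ <+: pre n γ} := by
      intro n
      rw [hA, hB, ← ENNReal.tsum_mul_left]
      apply ENNReal.tsum_le_tsum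
      intro U
      rw [hBU n U (hWK U U.2)]
      gcongr
      exact (hW U U.2).1
    have hup : ∀ n,
        μ {γ | GoodWord G o (pre n γ) ∧ (W : Set V) ⊆ satSet G (pre n γ) ∧ w₀ <+: pre n γ} ≤
        ENNReal.ofReal (c + ε) *
        μ {γ | GoodWord G o (pre n γ) ∧ (W : Set V) ⊆ satSet G (pre n γ)} := by
      intro n
      rw [hA, hB, ← ENNReal.tsum_mul_left]
      apply ENNReal.tsum_le_tsum
      intro U
      rw [hBU n U (hWK U U.2)]
      gcongr
      exact (hW U U.2).2
    constructor
    · have h1 : Tendsto (fun n => ENNReal.ofReal (c - ε) *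
          μ {γ | GoodWord G o (pre n γ) ∧ (W : Set V) ⊆ satSet G (pre n γ)}) atTop
          (nhds (ENNReal.ofReal (c - ε) * 1)) :=
        ENNReal.Tendsto.const_mul hlim (Or.inl one_ne_zero)
      rw [mul_one] at h1
      apply le_of_tendsto h1
      filter_upwards [eventually_ge_atTop w₀.length] with n hn
      refine (hlow n).trans (measure_mono ?_)
      rintro γ ⟨-, -, h⟩
      exact (prefix_pre_iff hn γ).1 h
    · have h1 : Tendsto (fun n => ENNReal.ofReal (c + ε) *
          μ {γ | GoodWord G o (pre n γ) ∧ (W : Set V) ⊆ satSet G (pre n γ)} +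
          (1 - μ {γ | GoodWord G o (pre n γ) ∧ (W : Set V) ⊆ satSet G (pre n γ)})) atTop
          (nhds (ENNReal.ofReal (c + ε) * 1 + (1 - 1))) :=
        (ENNReal.Tendsto.const_mul hlim (Or.inl one_ne_zero)).add
          (ENNReal.Tendsto.sub tendsto_const_nhds hlim (Or.inl ENNReal.one_ne_top))
      rw [mul_one, tsub_self, add_zero] at h1
      apply ge_of_tendsto h1
      filter_upwards [eventually_ge_atTop w₀.length] with n hn
      rw [← prob_compl_eq_one_sub (hmeasA W n)]
      refine le_trans (le_trans (measure_mono ?_) (measure_union_le _ _))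
        (add_le_add (hup n) le_rfl)
      intro γ h
      by_cases hγ : GoodWord G o (pre n γ) ∧ (W : Set V) ⊆ satSet G (pre n γ)
      · exact Or.inl ⟨hγ.1, hγ.2, (prefix_pre_iff hn γ).2 h⟩
      · exact Or.inr hγ
  have hcont : ∀ f : ℝ → ℝ, Continuous f → f 0 = c →
      Tendsto (fun ε => ENNReal.ofReal (f ε)) (nhdsWithin 0 (Set.Ioi 0))
        (nhds (ENNReal.ofReal c)) := by
    intro f hf h0
    rw [← h0]
    exact ((ENNReal.continuous_ofReal.comp hf).tendsto 0).mono_left nhdsWithin_le_nhds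
  apply le_antisymm
  · apply ge_of_tendsto (hcont (fun ε => c + ε) (by fun_prop) (by simp))
    filter_upwards [self_mem_nhdsWithin] with ε hε
    exact (hbound ε hε).2
  · apply le_of_tendsto (hcont (fun ε => c - ε) (by fun_prop) (by simp))
    filter_upwards [self_mem_nhdsWithin] with ε hε
    exact (hbound ε hε).1

theorem cyl_eq (o : V) (hG : G.IsSourcedEulerian o) (μ ν : Measure (ℕ → E))
    (hμ : ProperGibbs G o μ) (hν : ProperGibbs G o ν) (n : ℕ) (w : List E) :
    μ {γ | pre n γ = w} = ν {γ | pre n γ = w} := by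
  haveI : IsProbabilityMeasure μ := ⟨hμ.1⟩
  by_cases hn : w.length = n
  · subst hn
    by_cases hw : ∃ z, IsPathList G o z w
    · obtain ⟨z, hz⟩ := hw
      obtain ⟨γ₀, hγ₀⟩ := (ae_good G hμ).exists
      obtain ⟨c, hc⟩ := cyl_value G o hG hγ₀ w z hz
      rw [hc μ hμ, hc ν hν]
    · have h0 : ∀ ρ : Measure (ℕ → E), ProperGibbs G o ρ →
          ρ {γ | pre w.length γ = w} = 0 := by
        intro ρ hρ
        refine measure_mono_null ?_ (ae_iff.1 (ae_good G hρ))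
        intro γ hγ hg
        apply hw
        have h1 := pre_path G hg w.length
        have h2 : pre w.length γ = w := hγ
        rw [h2] at h1
        exact ⟨_, h1⟩
      rw [h0 μ hμ, h0 ν hν]
  · have : {γ : ℕ → E | pre n γ = w} = ∅ := by
      ext γ
      simp only [Set.mem_ofPred_eq, Set.mem_empty_iff_false, iff_false]
      rintro rfl
      exact hn (pre_length _ _)
    rw [this, measure_empty, measure_empty]

theorem pre_take {m n : ℕ} (h : m ≤ n) (γ : ℕ → E) : (pre n γ).take m = pre m γ := by
  have h1 := pre_le_pre h γ
  rw [List.prefix_iff_eq_take, pre_length] at h1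
  exact h1.symm

theorem unique_gibbs (o : V) (hG : G.IsSourcedEulerian o) (μ ν : Measure (ℕ → E))
    (hμ : ProperGibbs G o μ) (hν : ProperGibbs G o ν) : μ = ν := by
  haveI : IsProbabilityMeasure μ := ⟨hμ.1⟩
  refine ext_of_generate_finite
    {S : Set (ℕ → E) | ∃ (n : ℕ) (P : List E → Prop), S = {γ | P (pre n γ)}} ?_ ?_ ?_ ?_
  · apply le_antisymm
    · refine iSup_le (fun i => ?_)
      rintro _ ⟨S, -, rfl⟩
      apply MeasurableSpace.measurableSet_generateFrom
      refine ⟨i + 1, fun l => ∃ e ∈ S, l.getLast? = some e, ?_⟩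
      ext γ
      simp [pre_succ]
    · apply MeasurableSpace.generateFrom_le
      rintro _ ⟨n, P, rfl⟩
      exact measurable_pre n P
  · rintro _ ⟨n, P, rfl⟩ _ ⟨m, Q, rfl⟩ -
    refine ⟨max n m, fun l => P (l.take n) ∧ Q (l.take m), ?_⟩
    ext γ
    simp only [Set.mem_inter_iff, Set.mem_ofPred_eq, pre_take (le_max_left n m),
      pre_take (le_max_right n m)]
  · rintro _ ⟨n, P, rfl⟩
    rw [measure_words, measure_words]
    exact tsum_congr (fun w => cyl_eq G o hG μ ν hμ hν n w)
  · rw [hμ.1, hν.1]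

end Final

/-- On a sourced Eulerian digraph there is at most one proper Gibbs measure on
Eulerian paths from `o` to `∞`. -/
theorem stmt2 {V E : Type} [Countable V] [Countable E] [MeasurableSpace E]
    [DiscreteMeasurableSpace E]
    (G : DigraphStruct V E) (o : V) (hG : G.IsSourcedEulerian o)
    (μ ν : Measure (ℕ → E)) (hμ : ProperGibbs G o μ) (hν : ProperGibbs G o ν) :
    μ = ν := by
  exact unique_gibbs G o hG μ ν hμ hν

end DF
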